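/- arXiv:2112.04395 — 2 statements merged into one kernel-verified Lean document; each statement's English description precedes it below -/
import Mathlib

section
/- With high probability, for every two (not necessarily distinct) integers y₁, y₂ satisfying |y_j − n/2| ≤ (1/2)·√(n·(ln n − 2·√(ln n))) + 1 for j = 1,2, the graph G_n contains a pair of adjacent vertices of degrees y₁ and y₂ as well as a pair of non-adjacent vertices of degrees y₁ and y₂. -/
open Filter

/-- The degree of a vertex in a (possibly non-decidable) simple graph. -/
noncomputable def ndeg {V : Type*} (G : SimpleGraph V) (v : V) : ℕ :=
  Nat.card (G.neighborSet v)

/-- The probability that a uniformly random graph on the (finite) vertex type `V`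
belongs to the set `A`. -/
noncomputable def gprob {V : Type*} (A : Set (SimpleGraph V)) : ℝ :=
  (Nat.card A : ℝ) / 2 ^ (Nat.card V).choose 2

/-- `N_y`: the number of vertices of degree `y` in a graph on `Fin n`. -/
noncomputable def Ncount {n : ℕ} (G : SimpleGraph (Fin n)) (y : ℤ) : ℕ :=
  Set.ncard {v : Fin n | (ndeg G v : ℤ) = y}

/-- `ζ₁ = (ln(2π) + (3/2)·ln ln n) / ln n`. -/
noncomputable def zeta1 (n : ℕ) : ℝ :=
  (Real.log (2 * Real.pi) + (3 / 2) * Real.log (Real.log n)) / Real.log n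

/-- `ζ₂ = (ln(2π) + (5/2)·ln ln n) / ln n`. -/
noncomputable def zeta2 (n : ℕ) : ℝ :=
  (Real.log (2 * Real.pi) + (5 / 2) * Real.log (Real.log n)) / Real.log n

section Density

/-- The proportion of elements of a finite type that belong to `A`. -/
noncomputable def density {Ω : Type*} (A : Set Ω) : ℝ :=
  (A.ncard : ℝ) / Nat.card Ω

variable {Ω Ω' : Type*}

lemma density_nonneg (A : Set Ω) : 0 ≤ density A := by
  unfold density; positivity

lemma density_empty : density (∅ : Set Ω) = 0 := by simp [density]

lemma density_mono [Finite Ω] {A B : Set Ω} (h : A ⊆ B) : density A ≤ density B := by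
  unfold density
  gcongr
  exact Set.toFinite _

lemma density_union_le (A B : Set Ω) : density (A ∪ B) ≤ density A + density B := by
  unfold density
  rw [← add_div]
  gcongr
  exact_mod_cast Set.ncard_union_le A B

lemma density_biUnion_le {ι : Type*} (s : Finset ι) (A : ι → Set Ω) {ε : ℝ}
    (h : ∀ i ∈ s, density (A i) ≤ ε) : density (⋃ i ∈ s, A i) ≤ s.card * ε := by
  classical
  induction s using Finset.induction_on with
  | empty => simp [density_empty]
  | insert a s ha ih =>
    rw [Finset.set_biUnion_insert, Finset.card_insert_of_notMem ha]
    have h1 := ih fun i hi => h i (Finset.mem_insert_of_mem hi)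
    have h2 := h a (Finset.mem_insert_self a s)
    have h3 := density_union_le (A a) (⋃ i ∈ s, A i)
    push_cast
    linarith

lemma density_compl [Finite Ω] [Nonempty Ω] (A : Set Ω) : density Aᶜ = 1 - density A := by
  unfold density
  have h := Set.ncard_add_ncard_compl A
  have h0 : (0 : ℝ) < Nat.card Ω := by exact_mod_cast Nat.card_pos
  rw [← h] at h0 ⊢
  field_simp
  push_cast
  ring

lemma density_preimage_equiv (e : Ω ≃ Ω') (A : Set Ω') : density (e ⁻¹' A) = density A := by
  unfold density
  rw [Nat.card_congr e, Set.ncard_preimage_of_injective_subset_range e.injective (by simp)]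

lemma density_prod_le [Finite Ω] [Nonempty Ω] [Finite Ω'] (A : Set (Ω × Ω')) {ε : ℝ}
    (h : ∀ x, density {y | (x, y) ∈ A} ≤ ε) : density A ≤ ε := by
  classical
  have := Fintype.ofFinite Ω
  have h0 : (0 : ℝ) < Nat.card Ω := by exact_mod_cast Nat.card_pos
  have hA : A = ⋃ x ∈ (Finset.univ : Finset Ω), Prod.mk x '' {y | (x, y) ∈ A} := by
    ext ⟨x, y⟩; simp
  have key : (A.ncard : ℝ) ≤ ∑ x : Ω, (({y | (x, y) ∈ A} : Set Ω').ncard : ℝ) := by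
    have h1 := Finset.set_ncard_biUnion_le Finset.univ
      (fun x : Ω => Prod.mk x '' {y | (x, y) ∈ A})
    rw [← hA] at h1
    refine (Nat.cast_le.mpr h1).trans_eq ?_
    push_cast
    refine Finset.sum_congr rfl fun x _ => ?_
    rw [Set.ncard_image_of_injective _ (Prod.mk_right_injective x)]
  calc density A ≤ (∑ x : Ω, (({y | (x, y) ∈ A} : Set Ω').ncard : ℝ)) / Nat.card (Ω × Ω') := by
        unfold density; gcongr
    _ = (∑ x : Ω, density {y | (x, y) ∈ A}) / Nat.card Ω := by
        unfold density
        rw [← Finset.sum_div, Nat.card_prod, Nat.cast_mul, div_div, mul_comm]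
    _ ≤ (∑ x : Ω, ε) / Nat.card Ω := by gcongr with x; exact h x
    _ = ε := by
        rw [Finset.sum_const, nsmul_eq_mul, Finset.card_univ, ← Nat.card_eq_fintype_card]
        field_simp

lemma density_pi {α : Type*} [Fintype α] [Fintype Ω] (A : α → Set Ω) :
    density {f : α → Ω | ∀ v, f v ∈ A v} = ∏ v, density (A v) := by
  classical
  have h : {f : α → Ω | ∀ v, f v ∈ A v} = ↑(Fintype.piFinset fun v => (A v).toFinset) := by
    ext f; simp
  unfold density
  rw [h, Set.ncard_coe_finset, Fintype.card_piFinset, Nat.card_fun, Finset.prod_div_distrib]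
  simp [Set.ncard_eq_toFinset_card']

lemma density_le_one [Finite Ω] (A : Set Ω) : density A ≤ 1 := by
  unfold density
  refine div_le_one_of_le₀ ?_ (by positivity)
  exact_mod_cast Set.ncard_le_card A

end Density

section SubsetSizes

variable {β : Type*} [Fintype β]

lemma density_card_ne (k : ℕ) :
    density {s : Finset β | s.card ≠ k} =
      1 - ((Fintype.card β).choose k : ℝ) / 2 ^ Fintype.card β := by
  classical
  have h := density_compl {s : Finset β | s.card = k}
  have h2 : {s : Finset β | s.card = k} = ↑(Finset.powersetCard k (Finset.univ : Finset β)) := by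
    ext s; simp [Finset.mem_powersetCard]
  have h3 : density {s : Finset β | s.card = k} =
      ((Fintype.card β).choose k : ℝ) / 2 ^ Fintype.card β := by
    unfold density
    rw [h2, Set.ncard_coe_finset, Finset.card_powersetCard]
    simp
  rw [← h3, ← h]
  rfl

lemma density_forall_card_ne_le {α : Type*} [Fintype α] (S : Finset α) (k : α → ℕ) {p σ : ℝ}
    (hp : ∀ v ∈ S, p ≤ ((Fintype.card β).choose (k v) : ℝ) / 2 ^ Fintype.card β)
    (hp0 : 0 ≤ p) (hσ : σ ≤ S.card) :
    density {f : α → Finset β | ∀ v ∈ S, (f v).card ≠ k v} ≤ Real.exp (-(p * σ)) := by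
  classical
  have h : {f : α → Finset β | ∀ v ∈ S, (f v).card ≠ k v} =
      {f | ∀ v, f v ∈ {s : Finset β | v ∈ S → s.card ≠ k v}} := rfl
  rw [h, density_pi]
  calc ∏ v, density {s : Finset β | v ∈ S → s.card ≠ k v}
      ≤ ∏ v, (if v ∈ S then Real.exp (-p) else 1) := by
        refine Finset.prod_le_prod (fun v _ => density_nonneg _) fun v _ => ?_
        split_ifs with hv
        · have : {s : Finset β | v ∈ S → s.card ≠ k v} = {s : Finset β | s.card ≠ k v} := by
            simp [hv]
          rw [this, density_card_ne]
          have := Real.one_sub_le_exp_neg p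
          linarith [hp v hv]
        · exact density_le_one _
    _ = Real.exp (-p) ^ S.card := by simp [Finset.prod_ite_mem]
    _ = Real.exp (-(p * S.card)) := by rw [← Real.exp_nat_mul]; congr 1; ring
    _ ≤ Real.exp (-(p * σ)) := by gcongr

lemma density_le_of_expSum {Ω : Type*} [Fintype Ω] (X : Ω → ℝ) {c : ℝ} :
    density {ω | c ≤ X ω} ≤ Real.exp (-c) * ((∑ ω, Real.exp (X ω)) / Fintype.card Ω) := by
  classical
  unfold density
  rw [Nat.card_eq_fintype_card, ← mul_div_assoc]
  gcongr
  rw [Set.ncard_eq_toFinset_card', Finset.mul_sum]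
  calc ((({ω | c ≤ X ω} : Set Ω).toFinset.card : ℕ) : ℝ)
      = ∑ ω ∈ ({ω | c ≤ X ω} : Set Ω).toFinset, 1 := by simp
    _ ≤ ∑ ω ∈ ({ω | c ≤ X ω} : Set Ω).toFinset, Real.exp (-c) * Real.exp (X ω) := by
        refine Finset.sum_le_sum fun ω hω => ?_
        rw [← Real.exp_add]
        refine Real.one_le_exp ?_
        have : c ≤ X ω := by simpa using hω
        linarith
    _ ≤ _ := Finset.sum_le_sum_of_subset_of_nonneg (Finset.subset_univ _)
        fun ω _ _ => by positivity

lemma expSum_card (l : ℝ) :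
    (∑ s : Finset β, Real.exp (l * (2 * s.card - Fintype.card β))) / Fintype.card (Finset β) =
      Real.cosh l ^ Fintype.card β := by
  classical
  have h := Finset.sum_pow_mul_eq_add_pow (Real.exp l) (Real.exp (-l)) (Finset.univ : Finset β)
  rw [Finset.powerset_univ, Finset.card_univ] at h
  rw [Real.cosh_eq, div_pow, ← h, Fintype.card_finset]
  push_cast
  congr 1
  refine Finset.sum_congr rfl fun s _ => ?_
  rw [← Real.exp_nat_mul, ← Real.exp_nat_mul, ← Real.exp_add, Nat.cast_sub (Finset.card_le_univ s)]
  congr 1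
  ring

lemma density_card_deviation_le {m : ℕ} (hm : 0 < m) (hβ : Fintype.card β ≤ m) {T : ℝ}
    (hT : 0 ≤ T) :
    density {s : Finset β | T < |(s.card : ℝ) - (Fintype.card β : ℝ) / 2|} ≤
      2 * Real.exp (-(2 * T ^ 2 / m)) := by
  have hm' : (0 : ℝ) < m := by exact_mod_cast hm
  have key : ∀ l : ℝ, l ^ 2 = (2 * T / m) ^ 2 →
      density {s : Finset β | 4 * T ^ 2 / m ≤ l * (2 * s.card - Fintype.card β)} ≤
        Real.exp (-(2 * T ^ 2 / m)) := by
    intro l hl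
    refine (density_le_of_expSum _).trans ?_
    rw [expSum_card]
    have h1 : Real.cosh l ^ Fintype.card β ≤ Real.exp (2 * T ^ 2 / m) :=
      calc Real.cosh l ^ Fintype.card β ≤ Real.cosh l ^ m :=
            pow_le_pow_right₀ (Real.one_le_cosh l) hβ
        _ ≤ Real.exp (l ^ 2 / 2) ^ m := by
            gcongr
            exact Real.cosh_le_exp_half_sq l
        _ = Real.exp (2 * T ^ 2 / m) := by
            rw [← Real.exp_nat_mul, hl]; congr 1; field_simp
    calc _ ≤ Real.exp (-(4 * T ^ 2 / m)) * Real.exp (2 * T ^ 2 / m) := by gcongr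
      _ = _ := by rw [← Real.exp_add]; congr 1; ring
  have hsub : {s : Finset β | T < |(s.card : ℝ) - (Fintype.card β : ℝ) / 2|} ⊆
      {s : Finset β | 4 * T ^ 2 / m ≤ 2 * T / m * (2 * s.card - Fintype.card β)} ∪
      {s : Finset β | 4 * T ^ 2 / m ≤ -(2 * T / m) * (2 * s.card - Fintype.card β)} := by
    intro s hs
    have hs' : T < |(s.card : ℝ) - (Fintype.card β : ℝ) / 2| := hs
    have e : 4 * T ^ 2 / m = 2 * T / m * (2 * T) := by ring
    rcases lt_abs.mp hs' with h | h
    · left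
      show 4 * T ^ 2 / m ≤ 2 * T / m * (2 * s.card - Fintype.card β)
      rw [e]
      gcongr
      linarith
    · right
      show 4 * T ^ 2 / m ≤ -(2 * T / m) * (2 * s.card - Fintype.card β)
      rw [e, neg_mul_comm]
      gcongr
      linarith
  have h1 := key (2 * T / m) rfl
  have h2 := key (-(2 * T / m)) (by ring)
  linarith [density_mono hsub, density_union_le
    {s : Finset β | 4 * T ^ 2 / m ≤ 2 * T / m * (2 * s.card - Fintype.card β)}
    {s : Finset β | 4 * T ^ 2 / m ≤ -(2 * T / m) * (2 * s.card - Fintype.card β)}]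

end SubsetSizes

section CentralBinomial

lemma four_pow_le_sqrt_mul_centralBinom {M : ℕ} (hM : 0 < M) :
    (4 : ℝ) ^ M ≤ 2 * Real.sqrt M * M.centralBinom := by
  have key : (16 : ℝ) ^ M ≤ 4 * M * (M.centralBinom : ℝ) ^ 2 := by
    induction M, hM using Nat.le_induction with
    | base => norm_num [Nat.centralBinom]
    | succ M hM ih =>
      have h := Nat.succ_mul_centralBinom_succ M
      have h' : ((M : ℝ) + 1) * (M + 1).centralBinom = 2 * (2 * M + 1) * M.centralBinom := by
        exact_mod_cast h
      have hM' : (0 : ℝ) < (M : ℝ) + 1 := by positivity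
      have e : ((M + 1).centralBinom : ℝ) = 2 * (2 * M + 1) * M.centralBinom / (M + 1) := by
        field_simp; linarith
      rw [pow_succ, e]
      push_cast
      have e2 : 4 * ((M : ℝ) + 1) * (2 * (2 * M + 1) * M.centralBinom / (M + 1)) ^ 2 =
          4 * (2 * M + 1) ^ 2 / (M + 1) * (4 * (M.centralBinom : ℝ) ^ 2) := by
        field_simp
        ring
      rw [e2]
      have h3 : 4 * (M : ℝ) * 4 ≤ 4 * (2 * M + 1) ^ 2 / (M + 1) := by
        rw [le_div_iff₀ hM']; nlinarith
      nlinarith [sq_nonneg (M.centralBinom : ℝ)]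
  have h2 : ((4 : ℝ) ^ M) ^ 2 ≤ (2 * Real.sqrt M * M.centralBinom) ^ 2 := by
    rw [mul_pow, mul_pow, Real.sq_sqrt (Nat.cast_nonneg M), ← pow_mul, mul_comm M 2, pow_mul]
    norm_num
    linarith
  exact (pow_le_pow_iff_left₀ (by positivity) (by positivity) two_ne_zero).mp h2

lemma exp_mul_centralBinom_le_choose {M t : ℕ} (ht : t < M) :
    Real.exp (-((t : ℝ) ^ 2 / (M - t))) * M.centralBinom ≤ ((2 * M).choose (M + t) : ℝ) := by
  suffices h : ∀ i ≤ t, Real.exp (-((i : ℝ) ^ 2 / (M - t))) * M.centralBinom ≤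
      ((2 * M).choose (M + i) : ℝ) from h t le_rfl
  have htM : (0 : ℝ) < M - t := sub_pos.mpr (by exact_mod_cast ht)
  intro i
  induction i with
  | zero => simp [Nat.centralBinom]
  | succ i ih =>
    intro hi
    have h := ih (by omega)
    have hrec := Nat.choose_succ_right_eq (2 * M) (M + i)
    have hrec' : ((2 * M).choose (M + i + 1) : ℝ) * (M + i + 1) =
        (2 * M).choose (M + i) * (M - i) := by
      have e : 2 * M - (M + i) = M - i := by omega
      rw [e] at hrec
      have := congrArg (Nat.cast : ℕ → ℝ) hrec
      push_cast [Nat.cast_sub (show i ≤ M by omega)] at this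
      exact this
    have hi' : (i : ℝ) + 1 ≤ t := by exact_mod_cast hi
    have hMi : (0 : ℝ) < M - i := by linarith
    have hpos : (0 : ℝ) < M + i + 1 := by positivity
    have hratio : Real.exp (-((2 * i + 1) / (M - t))) ≤ ((M : ℝ) - i) / (M + i + 1) := by
      rw [Real.exp_neg, ← inv_div ((M : ℝ) + i + 1)]
      apply inv_anti₀ (by positivity)
      calc ((M : ℝ) + i + 1) / (M - i) = (2 * i + 1) / (M - i) + 1 := by field_simp; ring
        _ ≤ (2 * i + 1) / (M - t) + 1 := by gcongr; linarith
        _ ≤ _ := Real.add_one_le_exp _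
    have e : ((2 * M).choose (M + (i + 1)) : ℝ) =
        ((M : ℝ) - i) / (M + i + 1) * (2 * M).choose (M + i) := by
      rw [← add_assoc]; field_simp; linarith
    rw [e]
    calc Real.exp (-(((i + 1 : ℕ) : ℝ) ^ 2 / (M - t))) * M.centralBinom
        = Real.exp (-((2 * i + 1) / (M - t))) *
          (Real.exp (-((i : ℝ) ^ 2 / (M - t))) * M.centralBinom) := by
          rw [← mul_assoc, ← Real.exp_add]; congr 2; push_cast; ring
      _ ≤ _ := by gcongr

lemma le_choose_div_pow {M k : ℕ} {R : ℝ} (hRM : R < M) (hk : |(k : ℝ) - M| ≤ R) :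
    1 / (2 * Real.sqrt M) * Real.exp (-(R ^ 2 / (M - R))) ≤
      ((2 * M).choose k : ℝ) / 2 ^ (2 * M) := by
  have hR : 0 ≤ R := (abs_nonneg _).trans hk
  have hM : 0 < M := by exact_mod_cast hR.trans_lt hRM
  have hM' : (0 : ℝ) < M := by exact_mod_cast hM
  have key : ∀ t : ℕ, (t : ℝ) ≤ R → 1 / (2 * Real.sqrt M) * Real.exp (-(R ^ 2 / (M - R))) ≤
      ((2 * M).choose (M + t) : ℝ) / 2 ^ (2 * M) := by
    intro t ht
    have htM : t < M := by exact_mod_cast ht.trans_lt hRM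
    have h1 := exp_mul_centralBinom_le_choose htM
    have h2 := four_pow_le_sqrt_mul_centralBinom hM
    have h3 : Real.exp (-(R ^ 2 / (M - R))) ≤ Real.exp (-((t : ℝ) ^ 2 / (M - t))) := by
      have : (0 : ℝ) < M - R := by linarith
      gcongr
    have hs : 0 < Real.sqrt M := Real.sqrt_pos.mpr hM'
    rw [pow_mul, show (2 : ℝ) ^ 2 = 4 by norm_num, le_div_iff₀ (by positivity)]
    calc 1 / (2 * Real.sqrt M) * Real.exp (-(R ^ 2 / (M - R))) * 4 ^ M
        ≤ 1 / (2 * Real.sqrt M) * Real.exp (-((t : ℝ) ^ 2 / (M - t))) *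
          (2 * Real.sqrt M * M.centralBinom) := by gcongr
      _ = Real.exp (-((t : ℝ) ^ 2 / (M - t))) * M.centralBinom := by field_simp
      _ ≤ _ := h1
  rcases le_total M k with h | h
  · obtain ⟨t, rfl⟩ := Nat.exists_eq_add_of_le h
    refine key t ?_
    rw [abs_le] at hk
    push_cast at hk
    linarith
  · obtain ⟨t, ht⟩ := Nat.exists_eq_add_of_le h
    have := key t (by
      rw [ht, abs_le] at hk
      push_cast at hk
      linarith)
    rwa [← Nat.choose_symm (show k ≤ 2 * M by omega), show 2 * M - k = M + t by omega]

end CentralBinomial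

section GraphSplitting

lemma natCard_simpleGraph (V : Type*) [Finite V] :
    Nat.card (SimpleGraph V) = 2 ^ (Nat.card V).choose 2 := by
  let e : SimpleGraph V ≃ Set {e : Sym2 V // ¬ e.IsDiag} :=
    { toFun := fun G => {e | e.1 ∈ G.edgeSet}
      invFun := fun S => SimpleGraph.fromEdgeSet (Subtype.val '' S)
      left_inv := by
        intro G
        ext u v
        simp only [SimpleGraph.fromEdgeSet_adj, Set.mem_image, Subtype.exists]
        constructor
        · rintro ⟨⟨a, ha, h1, rfl⟩, -⟩
          exact h1
        · intro h
          exact ⟨⟨s(u, v), by simpa using h.ne, h, rfl⟩, h.ne⟩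
      right_inv := by
        intro S
        ext ⟨e, he⟩
        simp [he] }
  rw [Nat.card_congr e, ← Sym2.natCard_subtype_not_diag]
  have := Fintype.ofFinite {e : Sym2 V // ¬ e.IsDiag}
  simp [Nat.card_eq_fintype_card, Fintype.card_set]

lemma gprob_eq_density {V : Type*} [Finite V] (A : Set (SimpleGraph V)) :
    gprob A = density A := by
  unfold gprob density
  rw [natCard_simpleGraph, Nat.card_coe_set_eq]
  push_cast
  rfl

lemma ndeg_iso {V W : Type*} {G : SimpleGraph V} {G' : SimpleGraph W} (e : G ≃g G') (v : V) :
    ndeg G' (e v) = ndeg G v :=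
  (Nat.card_congr (e.mapNeighborSet v)).symm

variable {α β : Type*}

/-- The graph on `α ⊕ β` with prescribed induced graphs on `α` and `β`, in which `a : α` is joined
to exactly the elements of `f a` among `β`. -/
def joinGraph (H : SimpleGraph α) (K : SimpleGraph β) (f : α → Finset β) : SimpleGraph (α ⊕ β) where
  Adj
    | Sum.inl a, Sum.inl a' => H.Adj a a'
    | Sum.inr b, Sum.inr b' => K.Adj b b'
    | Sum.inl a, Sum.inr b => b ∈ f a
    | Sum.inr b, Sum.inl a => b ∈ f a
  symm := ⟨by
    rintro (a | b) (a' | b') h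
    · exact H.adj_symm h
    · exact h
    · exact h
    · exact K.adj_symm h⟩
  loopless := ⟨by
    rintro (a | b) h
    · exact H.loopless.irrefl a h
    · exact K.loopless.irrefl b h⟩

/-- A graph on `α ⊕ β` amounts to a graph on each part and a bipartite graph between them. -/
noncomputable def joinEquiv [Finite β] :
    (SimpleGraph β × SimpleGraph α) × (α → Finset β) ≃ SimpleGraph (α ⊕ β) where
  toFun x := joinGraph x.1.2 x.1.1 x.2
  invFun G := ((G.comap Sum.inr, G.comap Sum.inl),
    fun a => (Set.toFinite {b | G.Adj (Sum.inl a) (Sum.inr b)}).toFinset)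
  left_inv := by
    rintro ⟨⟨K, H⟩, f⟩
    simp only [Prod.mk.injEq]
    refine ⟨⟨?_, ?_⟩, ?_⟩
    · ext; rfl
    · ext; rfl
    · ext a b
      simp [joinGraph]
  right_inv := by
    intro G
    ext (a | b) (a' | b')
    · rfl
    · simp [joinGraph]
    · simp [joinGraph, G.adj_comm]
    · rfl

lemma ndeg_joinGraph_inl [Finite α] [Finite β] (H : SimpleGraph α) (K : SimpleGraph β)
    (f : α → Finset β) (a : α) :
    ndeg (joinGraph H K f) (Sum.inl a) = ndeg H a + (f a).card := by
  let e : (joinGraph H K f).neighborSet (Sum.inl a) ≃ H.neighborSet a ⊕ f a :=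
    { toFun := fun x => match x with
        | ⟨Sum.inl v, h⟩ => Sum.inl ⟨v, h⟩
        | ⟨Sum.inr v, h⟩ => Sum.inr ⟨v, h⟩
      invFun := fun x => match x with
        | Sum.inl v => ⟨Sum.inl v.1, v.2⟩
        | Sum.inr v => ⟨Sum.inr v.1, v.2⟩
      left_inv := by rintro ⟨v | v, h⟩ <;> rfl
      right_inv := by rintro (v | v) <;> rfl }
  unfold ndeg
  rw [Nat.card_congr e, Nat.card_sum]
  simp

lemma density_simpleGraph_equiv {V W : Type*} (e : V ≃ W) (A : Set (SimpleGraph W)) :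
    density (e.simpleGraph ⁻¹' A) = density A :=
  density_preimage_equiv _ _

lemma ndeg_simpleGraph_equiv {V W : Type*} (e : V ≃ W) (G : SimpleGraph V) (v : V) :
    ndeg (e.simpleGraph G) (e v) = ndeg G v :=
  ndeg_iso (G' := e.simpleGraph G)
    { toEquiv := e, map_rel_iff' := by intro a b; simp [Equiv.simpleGraph_apply] } v

lemma density_ndeg_deviation_le {m : ℕ} [Fintype α] (hα : Fintype.card α = m) (u : α) {T : ℝ}
    (hT : 0 ≤ T) :
    density {H : SimpleGraph α | T < |(ndeg H u : ℝ) - ((m : ℝ) - 1) / 2|} ≤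
      2 * Real.exp (-(2 * T ^ 2 / m)) := by
  classical
  have hm : 0 < m := hα ▸ Fintype.card_pos_iff.mpr ⟨u⟩
  have hcard : Fintype.card {a : α // ¬ a = u} = m - 1 := by
    rw [Fintype.card_subtype_compl, hα]; simp
  rw [← density_simpleGraph_equiv (Equiv.sumCompl (fun a : α => a = u)),
    ← density_preimage_equiv joinEquiv]
  refine density_prod_le _ fun ⟨K, H⟩ => ?_
  rw [← density_preimage_equiv
    (Equiv.funUnique {a : α // a = u} (Finset {a : α // ¬ a = u})).symm]
  refine le_trans (density_mono ?_)
    (density_card_deviation_le (β := {a : α // ¬ a = u}) hm (by omega) hT)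
  intro s hs
  have h1 := ndeg_simpleGraph_equiv (Equiv.sumCompl (fun a : α => a = u))
    (joinGraph H K (fun _ => s)) (Sum.inl ⟨u, rfl⟩)
  rw [ndeg_joinGraph_inl] at h1
  have h0 : ndeg H ⟨u, rfl⟩ = 0 := by
    unfold ndeg
    rw [Nat.card_eq_zero]
    left
    refine ⟨fun ⟨x, hx⟩ => ?_⟩
    exact hx.ne (Subsingleton.elim _ _)
  have h2 : T < |(ndeg ((Equiv.sumCompl (fun a : α => a = u)).simpleGraph
      (joinGraph H K (fun _ => s))) u : ℝ) - ((m : ℝ) - 1) / 2| := hs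
  rw [h0, zero_add] at h1
  change ndeg _ u = _ at h1
  rw [h1] at h2
  change T < |(s.card : ℝ) - (Fintype.card {a : α // ¬ a = u} : ℝ) / 2|
  rw [hcard, Nat.cast_sub hm]
  simpa using h2

/-- Every vertex of the left part has both a neighbour and a distinct non-neighbour in the left
part whose degree is any prescribed element of `Y`. -/
def RichLeft (Y : Finset ℕ) (G : SimpleGraph (α ⊕ β)) : Prop :=
  ∀ u : α, ∀ y ∈ Y, (∃ v, G.Adj (Sum.inl u) (Sum.inl v) ∧ ndeg G (Sum.inl v) = y) ∧
    ∃ v, v ≠ u ∧ ¬ G.Adj (Sum.inl u) (Sum.inl v) ∧ ndeg G (Sum.inl v) = y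

lemma density_not_richLeft_le [Fintype α] [Fintype β] (Y : Finset ℕ)
    (P : SimpleGraph α → Prop) {p σ : ℝ} (hp0 : 0 ≤ p)
    (hadj : ∀ H, P H → ∀ u, σ ≤ ({v | H.Adj u v} : Set α).ncard)
    (hnadj : ∀ H, P H → ∀ u, σ ≤ ({v | v ≠ u ∧ ¬ H.Adj u v} : Set α).ncard)
    (hdeg : ∀ H, P H → ∀ v, ∀ y ∈ Y, ∃ k : ℕ, y = ndeg H v + k ∧
      p ≤ ((Fintype.card β).choose k : ℝ) / 2 ^ Fintype.card β) :
    density {G : SimpleGraph (α ⊕ β) | ¬ RichLeft Y G} ≤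
      density {H : SimpleGraph α | ¬ P H} +
        Fintype.card α * (Y.card * (2 * Real.exp (-(p * σ)))) := by
  classical
  rw [← density_preimage_equiv joinEquiv]
  let A : Set ((SimpleGraph β × SimpleGraph α) × (α → Finset β)) := {x | ¬ P x.1.2}
  let B : Set ((SimpleGraph β × SimpleGraph α) × (α → Finset β)) :=
    {x | P x.1.2 ∧ ¬ RichLeft Y (joinGraph x.1.2 x.1.1 x.2)}
  have hsub : joinEquiv ⁻¹' {G : SimpleGraph (α ⊕ β) | ¬ RichLeft Y G} ⊆ A ∪ B := by
    intro x hx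
    by_cases h : P x.1.2
    · exact Or.inr ⟨h, hx⟩
    · exact Or.inl h
  refine (density_mono hsub).trans ((density_union_le A B).trans (add_le_add ?_ ?_))
  · rw [← density_preimage_equiv (Equiv.prodComm (α → Finset β) (SimpleGraph β × SimpleGraph α))]
    refine density_prod_le _ fun f => ?_
    refine density_prod_le _ fun K => ?_
    exact le_rfl
  · refine density_prod_le _ fun ⟨K, H⟩ => ?_
    by_cases hP : P H
    swap
    · have : {y | ((K, H), y) ∈ B} = ∅ := by
        ext y; simp [B, hP]
      rw [this, density_empty]
      positivity
    have key : ∀ S : Set α, σ ≤ S.ncard → ∀ y ∈ Y,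
        density {f : α → Finset β | ∀ v ∈ S, ndeg (joinGraph H K f) (Sum.inl v) ≠ y} ≤
          Real.exp (-(p * σ)) := by
      intro S hS y hy
      choose k hk hpk using fun v => hdeg H hP v y hy
      refine le_trans (density_mono ?_) (density_forall_card_ne_le S.toFinset k
        (fun v _ => hpk v) hp0 (by rwa [← Set.ncard_eq_toFinset_card']))
      intro f hf v hv hc
      refine hf v (by simpa using hv) ?_
      rw [ndeg_joinGraph_inl, hc, ← hk v]
    have hcover : {f | ((K, H), f) ∈ B} ⊆ ⋃ u ∈ (Finset.univ : Finset α), ⋃ y ∈ Y,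
        ({f : α → Finset β | ∀ v ∈ {v | H.Adj u v}, ndeg (joinGraph H K f) (Sum.inl v) ≠ y} ∪
        {f : α → Finset β | ∀ v ∈ {v | v ≠ u ∧ ¬ H.Adj u v},
          ndeg (joinGraph H K f) (Sum.inl v) ≠ y}) := by
      intro f hf
      have hf' : ¬ RichLeft Y (joinGraph H K f) := hf.2
      unfold RichLeft at hf'
      push Not at hf'
      obtain ⟨u, y, hy, h⟩ := hf'
      simp only [Set.mem_iUnion]
      refine ⟨u, Finset.mem_univ u, y, hy, ?_⟩
      by_cases hex : ∃ v, (joinGraph H K f).Adj (Sum.inl u) (Sum.inl v) ∧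
          ndeg (joinGraph H K f) (Sum.inl v) = y
      · right
        intro v hv
        exact h hex v hv.1 hv.2
      · left
        intro v hv hc
        exact hex ⟨v, hv, hc⟩
    refine (density_mono hcover).trans ?_
    rw [← Finset.card_univ]
    refine density_biUnion_le _ _ fun u _ => density_biUnion_le _ _ fun y hy => ?_
    refine (density_union_le _ _).trans ?_
    rw [two_mul]
    exact add_le_add (key _ (hadj H hP u) y hy) (key _ (hnadj H hP u) y hy)

end GraphSplitting

section Estimates

variable {q r m M : ℝ}

lemma radius_estimates (hr : 10 ≤ r) (hq : 6 * r ^ 5 ≤ q) (hm1 : q ^ 2 / r ^ 8 ≤ m)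
    (hm2 : m ≤ q ^ 2 / r ^ 8 + 2) (hM : q ^ 2 = m + 2 * M) {R : ℝ}
    (hR : R = 1 / 2 * Real.sqrt (q ^ 2 * (r ^ 2 - 2 * r)) + 2 + Real.sqrt (m * r ^ 2)) :
    R < M ∧ R ^ 2 / (M - R) ≤ r ^ 2 / 2 - r + 3 := by
  have hr0 : 0 < r := by linarith
  obtain ⟨w, hw⟩ : ∃ w, w = q / r ^ 3 := ⟨_, rfl⟩
  have hqw : q = w * r ^ 3 := by rw [hw]; field_simp
  have hw6 : 6 * r ^ 2 ≤ w := by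
    rw [hw, le_div_iff₀ (by positivity)]; linarith [hq, show 6 * r ^ 2 * r ^ 3 = 6 * r ^ 5 by ring]
  have hw0 : 0 < w := by nlinarith
  have hw2 : 2 ≤ w := by nlinarith
  have hwr : q ^ 2 / r ^ 8 = w ^ 2 / r ^ 2 := by rw [hqw]; field_simp
  rw [hwr] at hm1 hm2
  have hmr : m * r ^ 2 ≤ 2 * w ^ 2 := by
    have h1 : m * r ^ 2 ≤ (w ^ 2 / r ^ 2 + 2) * r ^ 2 := by gcongr
    have h2 : (w ^ 2 / r ^ 2 + 2) * r ^ 2 = w ^ 2 + 2 * r ^ 2 := by field_simp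
    nlinarith
  have hT : Real.sqrt (m * r ^ 2) ≤ 2 * w := by
    rw [Real.sqrt_le_left (by positivity)]; nlinarith
  have hs : 0 ≤ r ^ 2 - 2 * r := by nlinarith
  have hx0 := Real.sqrt_nonneg (q ^ 2 * (r ^ 2 - 2 * r))
  have hT0 := Real.sqrt_nonneg (m * r ^ 2)
  have hx2 := Real.sq_sqrt (show 0 ≤ q ^ 2 * (r ^ 2 - 2 * r) by positivity)
  obtain ⟨x, hx⟩ : ∃ x, x = 1 / 2 * Real.sqrt (q ^ 2 * (r ^ 2 - 2 * r)) := ⟨_, rfl⟩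
  rw [← hx] at hR
  have hxnn : 0 ≤ x := by rw [hx]; positivity
  have hxsq : x ^ 2 = w ^ 2 * r ^ 6 * (r ^ 2 - 2 * r) / 4 := by
    rw [hx, mul_pow, hx2, hqw]; ring
  have hxle : x ≤ w * r ^ 4 / 2 := by
    refine le_of_sq_le_sq ?_ (by positivity)
    rw [hxsq]
    have : 0 ≤ w ^ 2 * r ^ 6 * (2 * r) := by positivity
    nlinarith
  have hRle : R ≤ x + 3 * w := by rw [hR]; linarith
  have hR0 : 0 ≤ R := by rw [hR]; positivity
  have hr2 : 100 ≤ r ^ 2 := by nlinarith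
  have hr4 : 100 * r ^ 2 ≤ r ^ 4 := by nlinarith
  have hr6 : 100 * r ^ 4 ≤ r ^ 6 := by nlinarith [show r ^ 6 = r ^ 2 * r ^ 4 by ring]
  have hRsq : R ^ 2 ≤ w ^ 2 * r ^ 6 * ((r ^ 2 - 2 * r) / 4 + 1) := by
    have h1 : R ^ 2 ≤ (x + 3 * w) ^ 2 := by gcongr
    have h2 : w * x ≤ w * (w * r ^ 4 / 2) := by gcongr
    have h3 : w ^ 2 * (3 * r ^ 4 + 9) ≤ w ^ 2 * r ^ 6 := by
      gcongr; linarith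
    linarith
  have hRlin : R ≤ w ^ 2 * r ^ 2 / 6 := by
    have h1 : w * 6 ≤ w * r ^ 4 := by gcongr; linarith
    have h2 : w * r ^ 2 * (6 * r ^ 2) ≤ w * r ^ 2 * w := by gcongr
    linarith
  have hmle : m ≤ w ^ 2 := by
    have h1 : m * 2 ≤ m * r ^ 2 := by
      have : 0 ≤ m := le_trans (by positivity) hm1
      gcongr; linarith
    linarith
  have hMR : w ^ 2 * r ^ 6 / 2 - w ^ 2 * r ^ 4 / 2 ≤ M - R := by
    have e : q ^ 2 = w ^ 2 * r ^ 6 := by rw [hqw]; ring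
    have h1 : w ^ 2 * (1 + r ^ 2 / 3) ≤ w ^ 2 * r ^ 4 := by gcongr; linarith
    linarith
  have hpos : 0 < w ^ 2 * r ^ 6 / 2 - w ^ 2 * r ^ 4 / 2 := by
    have : w ^ 2 * r ^ 4 < w ^ 2 * r ^ 6 := by gcongr <;> linarith
    linarith
  refine ⟨by linarith, ?_⟩
  rw [div_le_iff₀ (by linarith)]
  have hc : 0 ≤ r ^ 2 / 2 - r + 3 := by nlinarith
  calc R ^ 2 ≤ w ^ 2 * r ^ 6 * ((r ^ 2 - 2 * r) / 4 + 1) := hRsq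
    _ ≤ (r ^ 2 / 2 - r + 3) * (w ^ 2 * r ^ 6 / 2 - w ^ 2 * r ^ 4 / 2) := by
      have : 0 ≤ w ^ 2 * r ^ 4 * (r ^ 2 / 4 + r / 2 - 3 / 2) := by
        apply mul_nonneg (by positivity); linarith
      linarith
    _ ≤ _ := by gcongr

lemma three_mul_sq_le_prob_mul (hr : 10 ≤ r) (hq : 6 * r ^ 5 ≤ q)
    (hqr : Real.exp (r ^ 2) = q ^ 2) (hexp : 24 * r ^ 10 ≤ Real.exp (r - 3))
    (hm1 : q ^ 2 / r ^ 8 ≤ m) (hM : q ^ 2 = m + 2 * M) (hM0 : 0 < M) {c : ℝ}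
    (hc : c ≤ r ^ 2 / 2 - r + 3) :
    3 * r ^ 2 ≤ 1 / (2 * Real.sqrt M) * Real.exp (-c) * (m / 4) := by
  have hr0 : 0 < r := by linarith
  have hq0 : 0 < q := lt_of_lt_of_le (by positivity) hq
  have hm0 : 0 < m := lt_of_lt_of_le (by positivity) hm1
  have hsq : Real.sqrt M ≤ q := by
    rw [Real.sqrt_le_left hq0.le]; linarith
  have hs0 : 0 < Real.sqrt M := Real.sqrt_pos.mpr hM0
  have hhalf : Real.exp (r ^ 2 / 2) = q := by
    refine (pow_left_inj₀ (Real.exp_pos _).le hq0.le two_ne_zero).mp ?_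
    rw [← hqr, ← Real.exp_nat_mul]; congr 1; push_cast; ring
  have h1 : Real.exp (r - 3) / q ≤ Real.exp (-c) := by
    rw [← hhalf, ← Real.exp_sub]; gcongr; linarith
  calc 3 * r ^ 2 = 1 / (2 * q) * (24 * r ^ 10 / q) * (q ^ 2 / r ^ 8 / 4) := by field_simp; norm_num
    _ ≤ 1 / (2 * Real.sqrt M) * (Real.exp (r - 3) / q) * (m / 4) := by gcongr
    _ ≤ _ := by gcongr

lemma quarter_le (hr : 10 ≤ r) (hq : 6 * r ^ 5 ≤ q) (hm1 : q ^ 2 / r ^ 8 ≤ m) :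
    m / 4 ≤ (m - 1) / 2 - Real.sqrt (m * r ^ 2) := by
  have hr0 : 0 < r := by linarith
  have h1 : 36 * r ^ 2 ≤ m := by
    refine le_trans ?_ hm1
    rw [le_div_iff₀ (by positivity)]
    calc 36 * r ^ 2 * r ^ 8 = (6 * r ^ 5) ^ 2 := by ring
      _ ≤ q ^ 2 := by gcongr
  have hm0 : 0 ≤ m := le_trans (by positivity) h1
  have h2 : Real.sqrt (m * r ^ 2) ≤ m / 6 := by
    rw [Real.sqrt_le_left (by positivity)]; nlinarith
  nlinarith

lemma eventually_sqrt_log_bounds :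
    ∀ᶠ n : ℕ in atTop, 0 < n ∧ 10 ≤ Real.sqrt (Real.log n) ∧
      6 * Real.sqrt (Real.log n) ^ 5 ≤ Real.sqrt n ∧
      24 * Real.sqrt (Real.log n) ^ 10 ≤ Real.exp (Real.sqrt (Real.log n) - 3) := by
  have hr : Tendsto (fun n : ℕ => Real.sqrt (Real.log n)) atTop atTop :=
    Real.tendsto_sqrt_atTop.comp (Real.tendsto_log_atTop.comp tendsto_natCast_atTop_atTop)
  have h1 : ∀ k : ℕ, ∀ c : ℝ, 0 < c → ∀ᶠ x : ℝ in atTop, c * x ^ k ≤ Real.exp x := by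
    intro k c hc
    filter_upwards [(Real.tendsto_exp_div_pow_atTop k).eventually_ge_atTop c,
      eventually_gt_atTop 0] with x hx hx0
    rwa [le_div_iff₀ (by positivity)] at hx
  filter_upwards [eventually_gt_atTop 0, hr.eventually_ge_atTop 10,
    hr.eventually (h1 5 6 (by norm_num)),
    hr.eventually (h1 10 (24 * Real.exp 3) (by positivity))] with n hn h10 h5 h24
  refine ⟨hn, h10, h5.trans ?_, ?_⟩
  · have hlog : 0 ≤ Real.log n := Real.log_natCast_nonneg n
    have hs := Real.sq_sqrt hlog
    have hn' : (0 : ℝ) < n := by exact_mod_cast hn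
    have e : Real.sqrt n = Real.exp (Real.log n / 2) := by
      rw [← Real.log_sqrt hn'.le, Real.exp_log (Real.sqrt_pos.mpr hn')]
    rw [e]
    gcongr
    nlinarith
  · rw [Real.exp_sub, le_div_iff₀ (Real.exp_pos 3)]
    linarith

end Estimates

lemma adjacent_and_nonadjacent_of_richLeft {α β V : Type*} [Nonempty α] {G : SimpleGraph V}
    {e : V ≃ α ⊕ β} {Y : Finset ℕ} (h : RichLeft Y (e.simpleGraph G)) {y₁ y₂ : ℕ}
    (h₁ : y₁ ∈ Y) (h₂ : y₂ ∈ Y) :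
    (∃ u v, G.Adj u v ∧ ndeg G u = y₁ ∧ ndeg G v = y₂) ∧
      ∃ u v, u ≠ v ∧ ¬ G.Adj u v ∧ ndeg G u = y₁ ∧ ndeg G v = y₂ := by
  have hdeg : ∀ x, ndeg G (e.symm x) = ndeg (e.simpleGraph G) x := fun x => by
    rw [← ndeg_simpleGraph_equiv e, e.apply_symm_apply]
  have hadj : ∀ x y, G.Adj (e.symm x) (e.symm y) ↔ (e.simpleGraph G).Adj x y := fun x y => Iff.rfl
  obtain ⟨⟨u, -, hu⟩, -⟩ := h (Classical.arbitrary α) y₁ h₁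
  obtain ⟨⟨v, huv, hv⟩, w, hwu, huw, hw⟩ := h u y₂ h₂
  refine ⟨⟨e.symm (Sum.inl u), e.symm (Sum.inl v), (hadj _ _).mpr huv, ?_, ?_⟩,
    e.symm (Sum.inl u), e.symm (Sum.inl w), ?_, fun hc => huw ((hadj _ _).mp hc), ?_, ?_⟩
  · rw [hdeg, hu]
  · rw [hdeg, hv]
  · intro hc
    exact hwu (Sum.inl_injective (e.symm.injective hc)).symm
  · rw [hdeg, hu]
  · rw [hdeg, hw]

lemma ncard_nonneighbors {α : Type*} [Finite α] (H : SimpleGraph α) (u : α) :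
    (({v | v ≠ u ∧ ¬ H.Adj u v} : Set α).ncard : ℝ) = Nat.card α - 1 - ndeg H u := by
  have h1 : ({v | v ≠ u ∧ ¬ H.Adj u v} : Set α) = (insert u (H.neighborSet u))ᶜ := by
    ext v; simp
  have h2 := Set.ncard_add_ncard_compl (insert u (H.neighborSet u))
  rw [Set.ncard_insert_of_notMem (by simp)] at h2
  rw [h1, ← h2]
  unfold ndeg
  rw [Nat.card_coe_set_eq]
  push_cast
  ring

lemma density_not_richLeft_le_of_split {n m M : ℕ} (hn : 0 < n) (hnm : m + 2 * M = n)
    (hr : 10 ≤ Real.sqrt (Real.log n))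
    (hq : 6 * Real.sqrt (Real.log n) ^ 5 ≤ Real.sqrt n)
    (hexp : 24 * Real.sqrt (Real.log n) ^ 10 ≤ Real.exp (Real.sqrt (Real.log n) - 3))
    (hm1 : Real.sqrt n ^ 2 / Real.sqrt (Real.log n) ^ 8 ≤ m)
    (hm2 : (m : ℝ) ≤ Real.sqrt n ^ 2 / Real.sqrt (Real.log n) ^ 8 + 2)
    {Y : Finset ℕ} (hYcard : Y.card ≤ n + 1)
    (hY : ∀ y ∈ Y, |(y : ℝ) - n / 2| ≤
      1 / 2 * Real.sqrt ((n : ℝ) * (Real.log n - 2 * Real.sqrt (Real.log n))) + 1) :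
    density {G : SimpleGraph (Fin m ⊕ Fin (2 * M)) | ¬ RichLeft Y G} ≤ 6 / n := by
  have hn' : (0 : ℝ) < n := by exact_mod_cast hn
  have hq2 : Real.sqrt n ^ 2 = n := Real.sq_sqrt hn'.le
  have hr2 : Real.sqrt (Real.log n) ^ 2 = Real.log n := Real.sq_sqrt (Real.log_natCast_nonneg n)
  have hnmR : (m : ℝ) + 2 * M = n := by exact_mod_cast hnm
  have hM : Real.sqrt n ^ 2 = m + 2 * M := by rw [hq2, hnmR]
  have hqr : Real.exp (Real.sqrt (Real.log n) ^ 2) = Real.sqrt n ^ 2 := by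
    rw [hr2, hq2, Real.exp_log hn']
  set r := Real.sqrt (Real.log n) with hrdef
  set q := Real.sqrt n with hqdef
  rw [← hr2, ← hq2] at hY
  obtain ⟨R, hR⟩ : ∃ R, R = 1 / 2 * Real.sqrt (q ^ 2 * (r ^ 2 - 2 * r)) + 2 +
    Real.sqrt (m * r ^ 2) := ⟨_, rfl⟩
  obtain ⟨hRM, hRle⟩ := radius_estimates hr hq hm1 hm2 hM hR
  have hR0 : 0 ≤ R := by rw [hR]; positivity
  have hM0 : (0 : ℝ) < M := hR0.trans_lt hRM
  have hprob := three_mul_sq_le_prob_mul hr hq hqr hexp hm1 hM hM0 hRle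
  have hquarter := quarter_le hr hq hm1
  obtain ⟨T, hT⟩ : ∃ T, T = Real.sqrt (m * r ^ 2) := ⟨_, rfl⟩
  rw [← hT] at hquarter hR
  have hT0 : 0 ≤ T := hT ▸ Real.sqrt_nonneg _
  have hq0 : 0 < q := Real.sqrt_pos.mpr hn'
  have hr0 : 0 < r := by linarith
  have hm0 : (0 : ℝ) < m := lt_of_lt_of_le (by positivity) hm1
  have hmn : (m : ℝ) ≤ n := by linarith
  have hP : density {H : SimpleGraph (Fin m) |
      ¬ ∀ u, |(ndeg H u : ℝ) - ((m : ℝ) - 1) / 2| ≤ T} ≤ 2 / n := by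
    have hcover : {H : SimpleGraph (Fin m) | ¬ ∀ u, |(ndeg H u : ℝ) - ((m : ℝ) - 1) / 2| ≤ T} ⊆
        ⋃ u ∈ (Finset.univ : Finset (Fin m)),
          {H : SimpleGraph (Fin m) | T < |(ndeg H u : ℝ) - ((m : ℝ) - 1) / 2|} := by
      intro H hH
      simpa using hH
    refine (density_mono hcover).trans ((density_biUnion_le _ _ fun u _ =>
      density_ndeg_deviation_le (Fintype.card_fin m) u hT0).trans ?_)
    have e1 : 2 * T ^ 2 / m = r ^ 2 + r ^ 2 := by
      rw [hT, Real.sq_sqrt (by positivity)]; field_simp; ring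
    rw [e1, neg_add, Real.exp_add, Real.exp_neg, hqr, hq2, Finset.card_univ, Fintype.card_fin]
    calc (m : ℝ) * (2 * ((n : ℝ)⁻¹ * (n : ℝ)⁻¹)) ≤ n * (2 * ((n : ℝ)⁻¹ * (n : ℝ)⁻¹)) := by gcongr
      _ = 2 / n := by field_simp
  have hmain := density_not_richLeft_le (α := Fin m) (β := Fin (2 * M)) Y
    (fun H => ∀ u, |(ndeg H u : ℝ) - ((m : ℝ) - 1) / 2| ≤ T)
    (p := 1 / (2 * Real.sqrt M) * Real.exp (-(R ^ 2 / (M - R)))) (σ := (m : ℝ) / 4)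
    (by positivity)
    (by
      intro H hH u
      have h := (abs_le.mp (hH u)).1
      change _ ≤ ((H.neighborSet u).ncard : ℝ)
      rw [← Nat.card_coe_set_eq]
      change _ ≤ (ndeg H u : ℝ)
      linarith)
    (by
      intro H hH u
      have h := (abs_le.mp (hH u)).2
      rw [ncard_nonneighbors, Nat.card_fin]
      linarith)
    (by
      intro H hH v y hy
      have h1 := abs_le.mp (hH v)
      have h2 := abs_le.mp (hY y hy)
      have hle : ndeg H v ≤ y := by
        have : (ndeg H v : ℝ) ≤ y := by linarith [h1.1, h1.2, h2.1, h2.2]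
        exact_mod_cast this
      refine ⟨y - ndeg H v, by omega, ?_⟩
      rw [Fintype.card_fin]
      refine le_choose_div_pow hRM ?_
      rw [Nat.cast_sub hle, abs_le]
      constructor <;> linarith [h1.1, h1.2, h2.1, h2.2])
  refine hmain.trans ?_
  have hexp3 : Real.exp (-(1 / (2 * Real.sqrt M) * Real.exp (-(R ^ 2 / (M - R))) * (m / 4))) ≤
      1 / (n : ℝ) ^ 3 := by
    have e : 1 / (n : ℝ) ^ 3 = Real.exp (-(3 * r ^ 2)) := by
      rw [Real.exp_neg, ← hq2, ← hqr, ← Real.exp_nat_mul, one_div]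
      norm_num
    rw [e]
    gcongr
  have hY' : (Y.card : ℝ) ≤ 2 * n := by
    have h1 : (Y.card : ℝ) ≤ n + 1 := by exact_mod_cast hYcard
    have h2 : (1 : ℝ) ≤ n := by exact_mod_cast hn
    linarith
  rw [Fintype.card_fin]
  calc _ ≤ 2 / (n : ℝ) + n * ((2 * n) * (2 * (1 / (n : ℝ) ^ 3))) := by gcongr
    _ = 6 / n := by field_simp; norm_num

lemma exists_even_split {n : ℕ} {s : ℝ} (hs : 0 ≤ s) (hsn : s ≤ n) :
    ∃ m M : ℕ, m + 2 * M = n ∧ s ≤ m ∧ (m : ℝ) ≤ s + 2 := by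
  have h1 := Nat.floor_le (show 0 ≤ ((n : ℝ) - s) / 2 by linarith)
  have h2 := Nat.lt_floor_add_one (((n : ℝ) - s) / 2)
  set M := ⌊((n : ℝ) - s) / 2⌋₊
  have hM : 2 * M ≤ n := by
    have : (2 : ℝ) * M ≤ n := by linarith
    exact_mod_cast this
  refine ⟨n - 2 * M, M, by omega, ?_, ?_⟩ <;>
  · rw [Nat.cast_sub hM]
    push_cast
    linarith

/-- Whp, for every two integers `y₁, y₂` with `|y_j − n/2| ≤ (1/2)·√(n·(ln n − 2√(ln n))) + 1`,
there is a pair of adjacent vertices of degrees `y₁, y₂` and a pair of non-adjacent distinct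
vertices of degrees `y₁, y₂`. -/
theorem adjacent_and_nonadjacent_pairs_whp :
    Tendsto (fun n : ℕ => gprob {G : SimpleGraph (Fin n) |
      ∀ y₁ y₂ : ℤ,
        |(y₁ : ℝ) - (n : ℝ) / 2| ≤
            (1 / 2) * Real.sqrt ((n : ℝ) * (Real.log n - 2 * Real.sqrt (Real.log n))) + 1 →
        |(y₂ : ℝ) - (n : ℝ) / 2| ≤
            (1 / 2) * Real.sqrt ((n : ℝ) * (Real.log n - 2 * Real.sqrt (Real.log n))) + 1 →
        (∃ u v : Fin n, G.Adj u v ∧ (ndeg G u : ℤ) = y₁ ∧ (ndeg G v : ℤ) = y₂) ∧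
        (∃ u v : Fin n, u ≠ v ∧ ¬ G.Adj u v ∧
          (ndeg G u : ℤ) = y₁ ∧ (ndeg G v : ℤ) = y₂)}) atTop (nhds 1) := by

  have hle_one : ∀ (n : ℕ) (A : Set (SimpleGraph (Fin n))), gprob A ≤ 1 := fun n A => by
    rw [gprob_eq_density]; exact density_le_one A
  have hlim : Tendsto (fun n : ℕ => 1 - 6 / (n : ℝ)) atTop (nhds 1) := by
    simpa using tendsto_const_nhds.sub (tendsto_const_div_atTop_nhds_zero_nat (6 : ℝ))
  refine tendsto_of_tendsto_of_tendsto_of_le_of_le' hlim tendsto_const_nhds ?_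
    (Eventually.of_forall fun n => hle_one n _)
  filter_upwards [eventually_sqrt_log_bounds] with n ⟨hn, hr, hq, hexp⟩
  have hn' : (0 : ℝ) < n := by exact_mod_cast hn
  have hq2 : Real.sqrt n ^ 2 = n := Real.sq_sqrt hn'.le
  have hr8 : (1 : ℝ) ≤ Real.sqrt (Real.log n) ^ 8 := one_le_pow₀ (by linarith)
  obtain ⟨m, M, hnm, hm1, hm2⟩ := exists_even_split (n := n)
    (s := Real.sqrt n ^ 2 / Real.sqrt (Real.log n) ^ 8) (by positivity)
    (by rw [hq2]; exact div_le_self hn'.le hr8)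
  classical
  let Y : Finset ℕ := (Finset.range (n + 1)).filter fun y => |(y : ℝ) - n / 2| ≤
      1 / 2 * Real.sqrt ((n : ℝ) * (Real.log n - 2 * Real.sqrt (Real.log n))) + 1
  have hbad := density_not_richLeft_le_of_split hn hnm hr hq hexp hm1 hm2 (Y := Y)
    ((Finset.card_filter_le _ _).trans (by simp)) (fun y hy => (Finset.mem_filter.mp hy).2)
  have hm0 : 0 < m := by
    have : (0 : ℝ) < m := lt_of_lt_of_le (div_pos (by rw [hq2]; exact hn') (by positivity)) hm1
    exact_mod_cast this
  have : Nonempty (Fin m) := ⟨⟨0, hm0⟩⟩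
  let e : Fin n ≃ Fin m ⊕ Fin (2 * M) := (finSumFinEquiv.trans (finCongr hnm)).symm
  have hcompl := density_compl {G : SimpleGraph (Fin m ⊕ Fin (2 * M)) | RichLeft Y G}
  rw [show {G : SimpleGraph (Fin m ⊕ Fin (2 * M)) | RichLeft Y G}ᶜ = {G | ¬ RichLeft Y G} from rfl]
    at hcompl
  have hgood : 1 - 6 / (n : ℝ) ≤
      density (e.simpleGraph ⁻¹' {G : SimpleGraph (Fin m ⊕ Fin (2 * M)) | RichLeft Y G}) := by
    rw [density_simpleGraph_equiv]
    linarith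
  refine hgood.trans ?_
  rw [gprob_eq_density]
  refine density_mono fun G hG => ?_
  have hwindow : 1 / 2 * Real.sqrt ((n : ℝ) * (Real.log n - 2 * Real.sqrt (Real.log n))) + 1 ≤
      (n : ℝ) / 2 := by
    have hnmR : (m : ℝ) + 2 * M = n := by exact_mod_cast hnm
    obtain ⟨hRM, -⟩ := radius_estimates hr hq hm1 hm2 (by rw [hq2, hnmR]) rfl
    rw [hq2, Real.sq_sqrt (Real.log_natCast_nonneg n)] at hRM
    have := Real.sqrt_nonneg ((m : ℝ) * Real.log n)
    have : (0 : ℝ) ≤ m := Nat.cast_nonneg m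
    linarith
  have hlift : ∀ y : ℤ, |(y : ℝ) - (n : ℝ) / 2| ≤
      (1 / 2) * Real.sqrt ((n : ℝ) * (Real.log n - 2 * Real.sqrt (Real.log n))) + 1 →
      ∃ k ∈ Y, (k : ℤ) = y := by
    intro y hy
    have h := abs_le.mp (hy.trans hwindow)
    have h0 : 0 ≤ y := by
      have : (0 : ℝ) ≤ y := by linarith [h.1]
      exact_mod_cast this
    obtain ⟨k, rfl⟩ := Int.eq_ofNat_of_zero_le h0
    refine ⟨k, Finset.mem_filter.mpr ⟨?_, by simpa using hy⟩, rfl⟩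
    have h1 : (k : ℝ) ≤ n := by
      have := h.2
      push_cast at this
      linarith
    have h2 : k ≤ n := by exact_mod_cast h1
    exact Finset.mem_range.mpr (by omega)
  intro y₁ y₂ hy₁ hy₂
  obtain ⟨k₁, hk₁, rfl⟩ := hlift y₁ hy₁
  obtain ⟨k₂, hk₂, rfl⟩ := hlift y₂ hy₂
  simpa only [Nat.cast_inj] using adjacent_and_nonadjacent_of_richLeft hG hk₁ hk₂
end

section
/- Let (S^↓_n) and (S^↑_n) be sequences of covering codes of lengths δ₁ = δ₁(n) and δ₂ = δ₂(n) respectively, each with asymptotically optimal density. Then √(n·ln n) · P[Y↓(G_n) ∈ S^↓_n] → 2 and √(n·ln n) · P[Y↑(G_n) ∈ S^↑_n] → 2 as n → ∞. -/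
open Filter

/-- The half-width `(1/2)·√(n·(ln n − 2·√(ln n)))` of the interval `D_n`. -/
noncomputable def bnd (n : ℕ) : ℝ :=
  (1 / 2) * Real.sqrt ((n : ℝ) * (Real.log n - 2 * Real.sqrt (Real.log n)))

/-- `d_*`: the smallest integer of `D_n = {d : |d − n/2| ≤ bnd n}`. -/
noncomputable def dstar (n : ℕ) : ℤ := Int.ceil ((n : ℝ) / 2 - bnd n)

/-- `d^*`: the largest integer of `D_n`. -/
noncomputable def dtop (n : ℕ) : ℤ := Int.floor ((n : ℝ) / 2 + bnd n)

/-- `δ₁ = |D_{n,1}|`, the number of integers in `[d_*, ⌊n/2⌋ − 1]`. -/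
noncomputable def delta1 (n : ℕ) : ℕ := (((n / 2 : ℕ) : ℤ) - dstar n).toNat

/-- `δ₂ = |D_{n,2}|`, the number of integers in `[⌊n/2⌋ + 1, d^*]`. -/
noncomputable def delta2 (n : ℕ) : ℕ := (dtop n - ((n / 2 : ℕ) : ℤ)).toNat

/-- `X_y`: the number of vertices `v` with `d_* ≤ deg(v) ≤ y`. -/
noncomputable def Xcount {n : ℕ} (G : SimpleGraph (Fin n)) (y : ℤ) : ℕ :=
  Set.ncard {v : Fin n | dstar n ≤ (ndeg G v : ℤ) ∧ (ndeg G v : ℤ) ≤ y}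

/-- `Y↓`: the vector of parities `(X_y mod 2)` for `y ∈ D_{n,1} = [d_*, ⌊n/2⌋ − 1]`. -/
noncomputable def Ydown {n : ℕ} (G : SimpleGraph (Fin n)) : Fin (delta1 n) → ZMod 2 :=
  fun j => (Xcount G (dstar n + (j : ℕ)) : ZMod 2)

/-- `Y↑`: the vector of parities `(X_y mod 2)` for `y ∈ D_{n,2} = [⌊n/2⌋ + 1, d^*]`. -/
noncomputable def Yup {n : ℕ} (G : SimpleGraph (Fin n)) : Fin (delta2 n) → ZMod 2 :=
  fun j => (Xcount G (((n / 2 : ℕ) : ℤ) + 1 + (j : ℕ)) : ZMod 2)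

/-- A covering code: every word of `{0,1}^m` is within Hamming distance 1 of a codeword. -/
def IsCoveringCode {m : ℕ} (S : Set (Fin m → ZMod 2)) : Prop :=
  ∀ x : Fin m → ZMod 2, ∃ c ∈ S, hammingDist x c ≤ 1

section RandomGraph

set_option linter.unusedSectionVars false

open Finset
open scoped Classical in
/-- The neighbourhood of a vertex, as a finset. -/
noncomputable def nb {V : Type*} [Fintype V] (G : SimpleGraph V) (v : V) : Finset V :=
  univ.filter (G.Adj v)

variable {V : Type*} [Fintype V] [DecidableEq V]

lemma mem_nb {G : SimpleGraph V} {v w : V} : w ∈ nb G v ↔ G.Adj v w := by simp [nb]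

lemma ndeg_eq_card_nb (G : SimpleGraph V) (v : V) : ndeg G v = (nb G v).card := by
  classical
  rw [ndeg, Nat.card_eq_fintype_card, SimpleGraph.card_neighborSet_eq_degree,
    ← SimpleGraph.card_neighborFinset_eq_degree]
  congr 1
  ext w
  simp [nb]

lemma nb_symmDiff (G H : SimpleGraph V) (v : V) :
    nb (symmDiff G H) v = symmDiff (nb G v) (nb H v) := by
  ext w
  simp [mem_nb, symmDiff, Finset.mem_union, Finset.mem_sdiff]

lemma card_simpleGraph : Fintype.card (SimpleGraph V) = 2 ^ (Fintype.card V).choose 2 := by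
  classical
  rw [← SimpleGraph.card_edgeFinset_top_eq_card_choose_two, ← Finset.card_powerset,
    ← Finset.card_univ]
  refine Finset.card_nbij' (fun G => G.edgeFinset)
    (fun S => SimpleGraph.fromEdgeSet (S : Set (Sym2 V))) ?_ ?_ ?_ ?_
  · intro G _
    simp
  · intro S _
    simp
  · intro G _
    simp
  · intro S hS
    have hS' : S ⊆ (⊤ : SimpleGraph V).edgeFinset :=
      Finset.mem_powerset.1 (Finset.mem_coe.1 hS)
    ext e
    have := @hS' e
    simp only [SimpleGraph.mem_edgeFinset, SimpleGraph.edgeSet_fromEdgeSet, Set.mem_sdiff,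
      Finset.mem_coe] at this ⊢
    constructor
    · exact fun h => h.1
    · intro h
      refine ⟨h, ?_⟩
      have h2 := this h
      intro h3
      exact SimpleGraph.not_isDiag_of_mem_edgeSet _ h2 h3

/-- Averaging over translates: a conditional bound for every translated family of graphs
gives an unconditional bound. -/
lemma card_filter_le_of_symmDiff {Ω : Type*} (s : Finset Ω) (hs : s.Nonempty)
    (N : Ω → SimpleGraph V) (E : SimpleGraph V → Prop) [DecidablePred E] (c : ℝ)
    (h : ∀ G, ((s.filter fun ω => E (symmDiff G (N ω))).card : ℝ) ≤ c * s.card) :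
    ((univ.filter E).card : ℝ) ≤ c * Fintype.card (SimpleGraph V) := by
  have h1 : ∀ ω, (univ.filter fun G => E (symmDiff G (N ω))).card = (univ.filter E).card := by
    intro ω
    refine Finset.card_nbij' (fun G => symmDiff G (N ω)) (fun G => symmDiff G (N ω)) ?_ ?_ ?_ ?_
    · intro G hG; simpa using hG
    · intro G hG; simpa using hG
    · intro G _; simp
    · intro G _; simp
  have h2 : ∑ ω ∈ s, (univ.filter fun G => E (symmDiff G (N ω))).card
      = ∑ G, (s.filter fun ω => E (symmDiff G (N ω))).card := by
    simp only [Finset.card_filter]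
    exact Finset.sum_comm
  simp only [h1, sum_const, smul_eq_mul] at h2
  have h3 : (s.card : ℝ) * ((univ.filter E).card : ℝ)
      = ∑ G, ((s.filter fun ω => E (symmDiff G (N ω))).card : ℝ) := by exact_mod_cast h2
  have h4 : (s.card : ℝ) * ((univ.filter E).card : ℝ)
      ≤ s.card * (c * Fintype.card (SimpleGraph V)) := by
    rw [h3]
    calc _ ≤ ∑ G : SimpleGraph V, c * (s.card : ℝ) := Finset.sum_le_sum fun G _ => h G
      _ = _ := by simp; ring
  have h5 : (0 : ℝ) < s.card := by exact_mod_cast hs.card_pos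
  exact le_of_mul_le_mul_left h4 h5

lemma card_filter_powerset_symmDiff (C N : Finset V) (Q : Finset V → Prop) [DecidablePred Q] :
    (C.powerset.filter fun S => Q ((symmDiff N S) ∩ C)).card = (C.powerset.filter Q).card := by
  have key : ∀ S ⊆ C, symmDiff N (symmDiff N S ∩ C) ∩ C = S := by
    intro S hS
    ext x
    have := @hS x
    simp only [mem_inter, mem_symmDiff]
    tauto
  refine Finset.card_nbij' (fun S => symmDiff N S ∩ C) (fun S => symmDiff N S ∩ C) ?_ ?_ ?_ ?_
  · intro S hS
    simp only [coe_filter, mem_powerset, Set.mem_ofPred_eq] at hS ⊢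
    exact ⟨inter_subset_right, hS.2⟩
  · intro S hS
    simp only [coe_filter, mem_powerset, Set.mem_ofPred_eq] at hS ⊢
    exact ⟨inter_subset_right, by rw [key S hS.1]; exact hS.2⟩
  · intro S hS
    simp only [coe_filter, mem_powerset, Set.mem_ofPred_eq] at hS
    exact key S hS.1
  · intro S hS
    simp only [coe_filter, mem_powerset, Set.mem_ofPred_eq] at hS
    exact key S hS.1

open scoped Classical in
/-- Chernoff bound for the size of a uniformly random subset. -/
lemma card_powerset_filter_deviation_le (C : Finset V) (s t : ℝ) (hs : 0 ≤ s) :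
    ((C.powerset.filter fun T => t < |(T.card : ℝ) - C.card / 2|).card : ℝ)
      ≤ 2 * 2 ^ C.card * Real.exp (C.card * s ^ 2 / 2 - 2 * s * t) := by
  have hsum : ∀ r : ℝ, ∑ T ∈ C.powerset, Real.exp (r * (2 * T.card - C.card))
      ≤ 2 ^ C.card * Real.exp (C.card * r ^ 2 / 2) := by
    intro r
    have h1 : ∑ T ∈ C.powerset, Real.exp (r * (2 * T.card - C.card))
        = (Real.exp r + Real.exp (-r)) ^ C.card := by
      rw [← Finset.sum_pow_mul_eq_add_pow]
      refine Finset.sum_congr rfl fun T hT => ?_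
      have hle : T.card ≤ C.card := Finset.card_le_card (Finset.mem_powerset.1 hT)
      rw [← Real.exp_nat_mul, ← Real.exp_nat_mul, ← Real.exp_add, Nat.cast_sub hle]
      congr 1
      ring
    have h2 : Real.exp r + Real.exp (-r) = 2 * Real.cosh r := by
      rw [Real.cosh_eq]; ring
    rw [h1, h2, mul_pow]
    refine mul_le_mul_of_nonneg_left ?_ (by positivity)
    calc Real.cosh r ^ C.card ≤ Real.exp (r ^ 2 / 2) ^ C.card :=
          pow_le_pow_left₀ (Real.cosh_pos r).le (Real.cosh_le_exp_half_sq r) _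
      _ = _ := by rw [← Real.exp_nat_mul]; congr 1; ring
  have hpt : ∀ T ∈ C.powerset.filter fun T => t < |(T.card : ℝ) - C.card / 2|,
      Real.exp (2 * s * t) ≤ Real.exp (s * (2 * T.card - C.card))
        + Real.exp ((-s) * (2 * T.card - C.card)) := by
    intro T hT
    have hT' := (Finset.mem_filter.1 hT).2
    rcases lt_abs.1 hT' with h | h
    · refine le_add_of_le_of_nonneg (Real.exp_le_exp.2 ?_) (Real.exp_pos _).le
      nlinarith
    · refine le_add_of_nonneg_of_le (Real.exp_pos _).le (Real.exp_le_exp.2 ?_)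
      nlinarith
  have h1 : ((C.powerset.filter fun T => t < |(T.card : ℝ) - C.card / 2|).card : ℝ)
      * Real.exp (2 * s * t) ≤ 2 * 2 ^ C.card * Real.exp (C.card * s ^ 2 / 2) := by
    calc _ = ∑ T ∈ C.powerset.filter (fun T => t < |(T.card : ℝ) - C.card / 2|),
          Real.exp (2 * s * t) := by simp
      _ ≤ ∑ T ∈ C.powerset.filter (fun T => t < |(T.card : ℝ) - C.card / 2|),
          (Real.exp (s * (2 * T.card - C.card))
            + Real.exp ((-s) * (2 * T.card - C.card))) := Finset.sum_le_sum hpt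
      _ ≤ ∑ T ∈ C.powerset, (Real.exp (s * (2 * T.card - C.card))
            + Real.exp ((-s) * (2 * T.card - C.card))) :=
          Finset.sum_le_sum_of_subset_of_nonneg (Finset.filter_subset _ _)
            fun _ _ _ => by positivity
      _ ≤ 2 ^ C.card * Real.exp (C.card * s ^ 2 / 2)
          + 2 ^ C.card * Real.exp (C.card * (-s) ^ 2 / 2) := by
          rw [Finset.sum_add_distrib]
          exact add_le_add (hsum s) (hsum (-s))
      _ = _ := by rw [neg_sq]; ring
  rw [Real.exp_sub, ← mul_div_assoc, le_div_iff₀ (Real.exp_pos _)]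
  exact h1

open scoped Classical in
/-- The number of neighbours of `a` in a set `C` is concentrated. -/
lemma card_filter_nb_deviation_le (a : V) (C : Finset V) (ha : a ∉ C) (s t : ℝ) (hs : 0 ≤ s) :
    ((univ.filter fun G : SimpleGraph V =>
        t < |((nb G a ∩ C).card : ℝ) - C.card / 2|).card : ℝ)
      ≤ 2 * Real.exp (C.card * s ^ 2 / 2 - 2 * s * t) * Fintype.card (SimpleGraph V) := by
  refine card_filter_le_of_symmDiff C.powerset ⟨∅, by simp⟩
    (fun S => SimpleGraph.fromEdgeSet {e | ∃ c ∈ S, e = s(a, c)}) _ _ fun G => ?_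
  have hnb : ∀ S ∈ C.powerset,
      nb (SimpleGraph.fromEdgeSet {e | ∃ c ∈ S, e = s(a, c)}) a = S := by
    intro S hS
    have hS' := Finset.mem_powerset.1 hS
    ext w
    simp only [mem_nb, SimpleGraph.fromEdgeSet_adj, Set.mem_ofPred_eq]
    constructor
    · rintro ⟨⟨c, hc, h⟩, hne⟩
      have : w = c := by
        have := Sym2.congr_right.1 h
        exact this
      rwa [this]
    · intro hw
      exact ⟨⟨w, hw, rfl⟩, fun h => ha (h ▸ hS' hw)⟩
  have h1 : (C.powerset.filter fun S => t < |((nb (symmDiff G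
      (SimpleGraph.fromEdgeSet {e | ∃ c ∈ S, e = s(a, c)})) a ∩ C).card : ℝ) - C.card / 2|)
      = C.powerset.filter fun S => t < |((symmDiff (nb G a) S ∩ C).card : ℝ) - C.card / 2| := by
    refine Finset.filter_congr fun S hS => ?_
    rw [nb_symmDiff, hnb S hS]
  rw [h1, card_filter_powerset_symmDiff C (nb G a)
    (fun T => t < |(T.card : ℝ) - C.card / 2|), Finset.card_powerset]
  refine (card_powerset_filter_deviation_le C s t hs).trans (le_of_eq ?_)
  push_cast
  ring

/-- The path `a - b - a'` (as a set of two edges). -/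
def cherry (a a' b : V) : SimpleGraph V := SimpleGraph.fromEdgeSet {s(a, b), s(a', b)}

lemma nb_cherry_center {a a' b : V} (hab : a ≠ b) (hab' : a' ≠ b) :
    nb (cherry a a' b) b = {a, a'} := by
  ext w
  simp only [mem_nb, cherry, SimpleGraph.fromEdgeSet_adj, Set.mem_insert_iff,
    Set.mem_singleton_iff, Sym2.eq_iff, Finset.mem_insert, Finset.mem_singleton]
  grind

lemma nb_cherry_end {a a' b v : V} (hvb : v ≠ b) (hv : v = a ∨ v = a') :
    nb (cherry a a' b) v = {b} := by
  ext w
  simp only [mem_nb, cherry, SimpleGraph.fromEdgeSet_adj, Set.mem_insert_iff,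
    Set.mem_singleton_iff, Sym2.eq_iff, Finset.mem_singleton]
  grind

lemma nb_cherry_other {a a' b v : V} (hvb : v ≠ b) (hva : v ≠ a) (hva' : v ≠ a') :
    nb (cherry a a' b) v = ∅ := by
  ext w
  simp only [mem_nb, cherry, SimpleGraph.fromEdgeSet_adj, Set.mem_insert_iff,
    Set.mem_singleton_iff, Sym2.eq_iff, Finset.notMem_empty]
  grind

lemma erase_nb_symmDiff_cherry {a a' b v : V} (G : SimpleGraph V) (hvb : v ≠ b) :
    (nb (symmDiff G (cherry a a' b)) v).erase b = (nb G v).erase b := by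
  rw [nb_symmDiff]
  by_cases hv : v = a ∨ v = a'
  · rw [nb_cherry_end hvb hv]
    ext w
    simp only [mem_erase, mem_symmDiff, Finset.mem_singleton]
    tauto
  · push Not at hv
    rw [nb_cherry_other hvb hv.1 hv.2]
    ext w
    simp [mem_symmDiff]

lemma mem_nb_symmDiff_cherry_end {a a' b v : V} (G : SimpleGraph V) (hvb : v ≠ b)
    (hv : v = a ∨ v = a') : b ∈ nb (symmDiff G (cherry a a' b)) v ↔ b ∉ nb G v := by
  rw [nb_symmDiff, nb_cherry_end hvb hv]
  simp [mem_symmDiff]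

lemma nb_symmDiff_cherry_other {a a' b v : V} (G : SimpleGraph V) (hvb : v ≠ b)
    (hva : v ≠ a) (hva' : v ≠ a') : nb (symmDiff G (cherry a a' b)) v = nb G v := by
  rw [nb_symmDiff, nb_cherry_other hvb hva hva']
  ext w
  simp [mem_symmDiff]

lemma card_nb_symmDiff_cherry_center {a a' b : V} (G : SimpleGraph V) (haa : a ≠ a')
    (hab : a ≠ b) (hab' : a' ≠ b) (hd : ¬(b ∈ nb G a ↔ b ∈ nb G a')) :
    (nb (symmDiff G (cherry a a' b)) b).card = (nb G b).card := by
  rw [nb_symmDiff, nb_cherry_center hab hab']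
  have hs : ∀ v, b ∈ nb G v ↔ v ∈ nb G b := fun v => by simp [mem_nb, SimpleGraph.adj_comm]
  rw [hs, hs] at hd
  have main : ∀ x y : V, x ≠ y → ∀ N : Finset V, x ∈ N → y ∉ N →
      (symmDiff N {x, y}).card = N.card := by
    intro x y hxy N hx hy
    have : symmDiff N {x, y} = insert y (N.erase x) := by
      ext w
      simp only [mem_symmDiff, Finset.mem_insert, Finset.mem_singleton, mem_erase]
      grind
    rw [this, Finset.card_insert_of_notMem (by simp [hy]), Finset.card_erase_of_mem hx]
    have := Finset.card_pos.2 ⟨x, hx⟩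
    omega
  by_cases h : a ∈ nb G b
  · exact main a a' haa _ h (by tauto)
  · rw [Finset.pair_comm]
    exact main a' a haa.symm _ (by tauto) h

lemma card_nb_eq_erase (G : SimpleGraph V) (v b : V) :
    (nb G v).card = ((nb G v).erase b).card + if b ∈ nb G v then 1 else 0 := by
  split_ifs with h
  · exact (Finset.card_erase_add_one h).symm
  · rw [Finset.erase_eq_of_notMem h, add_zero]

/-- The pair `a`, `a'` covers the level `y`: swapping the adjacencies of `a` and `a'` to `b`
moves one of them between the degrees `y` and `y + 1`, and the other one between `v` and `v + 1`
for some `v ∈ Q`. -/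
def Covers (G : SimpleGraph V) (a a' b : V) (Q : Finset ℕ) (y : ℤ) : Prop :=
  ¬(b ∈ nb G a ↔ b ∈ nb G a') ∧ (((nb G a).erase b).card : ℤ) = y ∧
    ((nb G a').erase b).card ∈ Q

lemma covers_symmDiff_cherry_iff {ι : Type*} {p : ι × Bool → V} (hp : Function.Injective p)
    {b : V} (hb : ∀ x, p x ≠ b) (G : SimpleGraph V) (Q : Finset ℕ) (y : ℤ) (i j : ι) :
    Covers (symmDiff G (cherry (p (i, false)) (p (i, true)) b)) (p (j, false)) (p (j, true)) b Q y
      ↔ Covers G (p (j, false)) (p (j, true)) b Q y := by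
  unfold Covers
  rw [erase_nb_symmDiff_cherry G (hb _), erase_nb_symmDiff_cherry G (hb _)]
  by_cases hij : j = i
  · subst hij
    rw [mem_nb_symmDiff_cherry_end G (hb _) (Or.inl rfl),
      mem_nb_symmDiff_cherry_end G (hb _) (Or.inr rfl), not_iff_not]
  · rw [nb_symmDiff_cherry_other G (hb _) (hp.ne (by simp [hij])) (hp.ne (by simp [hij])),
      nb_symmDiff_cherry_other G (hb _) (hp.ne (by simp [hij])) (hp.ne (by simp [hij]))]

lemma Xcount_cast {n : ℕ} (G : SimpleGraph (Fin n)) (y : ℤ) :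
    (Xcount G y : ZMod 2)
      = ∑ v, if dstar n ≤ ((nb G v).card : ℤ) ∧ ((nb G v).card : ℤ) ≤ y then 1 else 0 := by
  classical
  rw [Xcount, Finset.sum_boole, Set.ncard_eq_toFinset_card']
  congr 2
  ext v
  simp [ndeg_eq_card_nb]

/-- Effect of a swap on the parities of the counts. -/
lemma Xcount_symmDiff_cherry {n : ℕ} (G : SimpleGraph (Fin n)) {a a' b : Fin n}
    (haa : a ≠ a') (hab : a ≠ b) (hab' : a' ≠ b) {Q : Finset ℕ} {u : ℤ}
    (hc : Covers G a a' b Q u) (hu : dstar n ≤ u) (hQ : ∀ v ∈ Q, dstar n ≤ (v : ℤ))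
    (y : ℤ) (hy : ∀ v ∈ Q, (v : ℤ) ≠ y) :
    (Xcount (symmDiff G (cherry a a' b)) y : ZMod 2)
      = (Xcount G y : ZMod 2) + if u = y then 1 else 0 := by
  obtain ⟨hd, hcu, hcv⟩ := hc
  set f : SimpleGraph (Fin n) → Fin n → ZMod 2 := fun G v =>
    if dstar n ≤ ((nb G v).card : ℤ) ∧ ((nb G v).card : ℤ) ≤ y then 1 else 0 with hf
  set G' := symmDiff G (cherry a a' b) with hG'
  have hX : ∀ H, (Xcount H y : ZMod 2) = ∑ v, f H v := fun H => Xcount_cast H y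
  have h2 : ∀ z : ZMod 2, z + z = 0 := by decide
  have key : ∀ v, v ≠ b → (v = a ∨ v = a') → ∀ w : ℕ, ((nb G v).erase b).card = w →
      dstar n ≤ (w : ℤ) → f G' v + f G v = if (w : ℤ) = y then 1 else 0 := by
    intro v hvb hv w hw hdw
    have e1 := card_nb_eq_erase G v b
    have e2 := card_nb_eq_erase G' v b
    rw [hG', erase_nb_symmDiff_cherry G hvb, ← hG', hw] at e2
    rw [hw] at e1
    have e3 := mem_nb_symmDiff_cherry_end G hvb hv
    rw [← hG'] at e3
    simp only [hf]
    rw [e1, e2]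
    by_cases h : b ∈ nb G v
    · have h' : b ∉ nb G' v := fun hh => (e3.1 hh) h
      simp only [h, h', if_true, if_false]
      grind
    · have h' : b ∈ nb G' v := e3.2 h
      simp only [h, h', if_true, if_false]
      grind
  have hother : ∀ v, v ≠ a → v ≠ a' → f G' v + f G v = 0 := by
    intro v hva hva'
    have : f G' v = f G v := by
      simp only [hf]
      by_cases hvb : v = b
      · subst hvb
        rw [hG', card_nb_symmDiff_cherry_center G haa hab hab' hd]
      · rw [hG', nb_symmDiff_cherry_other G hvb hva hva']
    rw [this, h2]
  have hsum : (Xcount G' y : ZMod 2) + Xcount G y = if u = y then 1 else 0 := by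
    rw [hX, hX, ← Finset.sum_add_distrib,
      Finset.sum_eq_add_of_mem a a' (mem_univ _) (mem_univ _) haa
        (fun v _ hv => hother v hv.1 hv.2)]
    rw [key a hab (Or.inl rfl) _ rfl (by rw [hcu]; exact hu),
      key a' hab' (Or.inr rfl) _ rfl (hQ _ hcv), hcu, if_neg (hy _ hcv), add_zero]
  rw [← hsum, add_comm ((Xcount G' y : ZMod 2)), ← add_assoc, h2, zero_add]

lemma card_filter_eq_of_single_invariant {δ : ℕ} (N : (Fin δ → ZMod 2) → ℕ)
    (h : ∀ w j, N (w + Pi.single j 1) = N w) (w : Fin δ → ZMod 2) : N w = N 0 := by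
  have hgen : ∀ (s : Finset (Fin δ)) (v : Fin δ → ZMod 2),
      N (v + ∑ j ∈ s, Pi.single j (w j)) = N v := by
    intro s
    induction s using Finset.induction_on with
    | empty => intro v; simp
    | insert j s hj ih =>
      intro v
      rw [Finset.sum_insert hj, ← add_assoc, ih]
      have h01 : ∀ z : ZMod 2, z = 0 ∨ z = 1 := by decide
      rcases h01 (w j) with h0 | h0
      · simp [h0]
      · rw [h0]; exact h v j
  have := hgen univ 0
  rwa [Finset.univ_sum_single, zero_add] at this

open scoped Classical in
/-- Conditionally on every level being covered, the parity vector is exactly uniform. -/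
lemma card_covered_filter_mul {n δ : ℕ} {ι : Type*} {p : ι × Bool → Fin n}
    (hp : Function.Injective p) {b : Fin n} (hb : ∀ x, p x ≠ b) (Q : Finset ℕ) (lo : ℤ)
    (hlo : dstar n ≤ lo) (hQ : ∀ v ∈ Q, dstar n ≤ (v : ℤ))
    (hQlo : ∀ v ∈ Q, ∀ j : Fin δ, (v : ℤ) ≠ lo + (j : ℕ)) (S : Set (Fin δ → ZMod 2)) :
    (univ.filter fun G : SimpleGraph (Fin n) =>
        (∀ j : Fin δ, ∃ i, Covers G (p (i, false)) (p (i, true)) b Q (lo + (j : ℕ))) ∧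
        (fun j : Fin δ => (Xcount G (lo + (j : ℕ)) : ZMod 2)) ∈ S).card * 2 ^ δ
      = (univ.filter fun G : SimpleGraph (Fin n) =>
        ∀ j : Fin δ, ∃ i, Covers G (p (i, false)) (p (i, true)) b Q (lo + (j : ℕ))).card
          * Nat.card S := by
  set Good : SimpleGraph (Fin n) → Prop := fun G =>
    ∀ j : Fin δ, ∃ i, Covers G (p (i, false)) (p (i, true)) b Q (lo + (j : ℕ)) with hGood
  set Y : SimpleGraph (Fin n) → Fin δ → ZMod 2 :=
    fun G j => (Xcount G (lo + (j : ℕ)) : ZMod 2) with hY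
  have hinj : ∀ i, p (i, false) ≠ p (i, true) := fun i => hp.ne (by simp)
  have hgood_inv : ∀ G i, Good (symmDiff G (cherry (p (i, false)) (p (i, true)) b)) ↔ Good G := by
    intro G i
    simp only [hGood]
    refine forall_congr' fun j => exists_congr fun i' => ?_
    exact covers_symmDiff_cherry_iff hp hb G Q _ i i'
  have hN : ∀ w j, (univ.filter fun G => Good G ∧ Y G = w + Pi.single j 1).card
      = (univ.filter fun G => Good G ∧ Y G = w).card := by
    intro w j
    set P : SimpleGraph (Fin n) → ι → Prop := fun G i =>
      Covers G (p (i, false)) (p (i, true)) b Q (lo + (j : ℕ)) with hP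
    have hsel : ∃ σ : (ι → Prop) → Option ι, ∀ R : ι → Prop, ∀ i, R i →
        ∃ i', σ R = some i' ∧ R i' := by
      refine ⟨fun R => if h : ∃ i, R i then some h.choose else none, fun R i hi => ?_⟩
      have h : ∃ i, R i := ⟨i, hi⟩
      exact ⟨h.choose, by simp [h], h.choose_spec⟩
    obtain ⟨σ, hσ⟩ := hsel
    set τ : SimpleGraph (Fin n) → SimpleGraph (Fin n) := fun G =>
      (σ (P G)).elim G fun i => symmDiff G (cherry (p (i, false)) (p (i, true)) b) with hτ
    have hττ : ∀ G, Good G → Good (τ G) ∧ τ (τ G) = G ∧ Y (τ G) = Y G + Pi.single j 1 := by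
      intro G hG
      obtain ⟨i, hi⟩ := hG j
      obtain ⟨i', hi', hPi'⟩ := hσ (P G) i hi
      have hτG : τ G = symmDiff G (cherry (p (i', false)) (p (i', true)) b) := by
        simp [hτ, hi']
      have hPτ : P (τ G) = P G := by
        funext i''
        rw [hτG]
        exact propext (covers_symmDiff_cherry_iff hp hb G Q _ i' i'')
      refine ⟨?_, ?_, ?_⟩
      · rw [hτG, hgood_inv]; exact hG
      · have : τ (τ G) = symmDiff (τ G) (cherry (p (i', false)) (p (i', true)) b) := by
          change (σ (P (τ G))).elim (τ G) (fun i => symmDiff (τ G) _) = _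
          rw [hPτ, hi', Option.elim_some]
        rw [this, hτG, symmDiff_symmDiff_cancel_right]
      · funext l
        simp only [hY, Pi.add_apply]
        rw [hτG, Xcount_symmDiff_cherry G (hinj _) (hb _) (hb _) hPi' (by omega) hQ _
          (fun v hv => hQlo v hv l)]
        congr 1
        rw [Pi.single_apply]
        refine if_congr ?_ rfl rfl
        rw [add_right_inj, Nat.cast_inj, Fin.val_inj, eq_comm]
    have hcancel : ∀ z : Fin δ → ZMod 2, z + Pi.single j 1 + Pi.single j 1 = z := by
      intro z
      have h2 : ∀ z : ZMod 2, z + z = 0 := by decide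
      rw [add_assoc, ← Pi.single_add, h2, Pi.single_zero, add_zero]
    refine Finset.card_nbij' τ τ ?_ ?_ ?_ ?_
    · intro G hG
      simp only [coe_filter, mem_univ, true_and, Set.mem_ofPred_eq] at hG ⊢
      obtain ⟨h1, h2, h3⟩ := hττ G hG.1
      exact ⟨h1, by rw [h3, hG.2, hcancel]⟩
    · intro G hG
      simp only [coe_filter, mem_univ, true_and, Set.mem_ofPred_eq] at hG ⊢
      obtain ⟨h1, h2, h3⟩ := hττ G hG.1
      exact ⟨h1, by rw [h3, hG.2]⟩
    · intro G hG
      simp only [coe_filter, mem_univ, true_and, Set.mem_ofPred_eq] at hG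
      exact (hττ G hG.1).2.1
    · intro G hG
      simp only [coe_filter, mem_univ, true_and, Set.mem_ofPred_eq] at hG
      exact (hττ G hG.1).2.1
  have hconst := card_filter_eq_of_single_invariant
    (fun w => (univ.filter fun G => Good G ∧ Y G = w).card) hN
  have hfib : ∀ R : (Fin δ → ZMod 2) → Prop, (univ.filter fun G => Good G ∧ R (Y G)).card
      = (univ.filter R).card * (univ.filter fun G => Good G ∧ Y G = 0).card := by
    intro R
    rw [Finset.card_eq_sum_card_fiberwise (f := Y) (t := univ.filter R)
      (fun G hG => by
        simp only [coe_filter, mem_univ, true_and, Set.mem_ofPred_eq] at hG ⊢; exact hG.2)]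
    rw [Finset.sum_congr rfl (g := fun _ => (univ.filter fun G => Good G ∧ Y G = 0).card),
      Finset.sum_const, smul_eq_mul]
    intro w hw
    rw [← hconst w, Finset.filter_filter]
    congr 1
    refine Finset.filter_congr fun G _ => ?_
    have hRw := (Finset.mem_filter.1 hw).2
    constructor
    · rintro ⟨⟨h1, _⟩, h3⟩; exact ⟨h1, h3⟩
    · rintro ⟨h1, h3⟩; exact ⟨⟨h1, h3 ▸ hRw⟩, h3⟩
  have h1 := hfib (fun w => w ∈ S)
  have h2 := hfib (fun _ => True)
  simp only [and_true, Finset.filter_true, Finset.card_univ, Fintype.card_fun,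
    Fintype.card_fin, ZMod.card] at h2
  rw [h1, h2, Nat.card_eq_fintype_card, Fintype.card_subtype]
  ring

lemma card_powerset_filter_mem_ge (B : Finset V) {b : V} (hb : b ∉ B) (R : ℕ → Prop)
    [DecidablePred R] :
    (B.powerset.filter fun T => R T.card).card
      ≤ ((insert b B).powerset.filter fun T => b ∈ T ∧ R (T.erase b).card).card := by
  refine Finset.card_le_card_of_injOn (fun T => insert b T) ?_ ?_
  · intro T hT
    simp only [coe_filter, mem_powerset, Set.mem_ofPred_eq] at hT ⊢
    refine ⟨Finset.insert_subset_insert b hT.1, Finset.mem_insert_self _ _, ?_⟩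
    rw [Finset.erase_insert fun h => hb (hT.1 h)]
    exact hT.2
  · intro T hT T' hT' h
    simp only [coe_filter, mem_powerset, Set.mem_ofPred_eq] at hT hT'
    have := congrArg (fun U => Finset.erase U b) h
    simpa [Finset.erase_insert fun h => hb (hT.1 h),
      Finset.erase_insert fun h => hb (hT'.1 h)] using this

lemma card_powerset_filter_notMem_ge (B : Finset V) {b : V} (hb : b ∉ B) (R : ℕ → Prop)
    [DecidablePred R] :
    (B.powerset.filter fun T => R T.card).card
      ≤ ((insert b B).powerset.filter fun T => b ∉ T ∧ R (T.erase b).card).card := by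
  refine Finset.card_le_card fun T hT => ?_
  simp only [Finset.mem_filter, mem_powerset] at hT ⊢
  have hbT : b ∉ T := fun h => hb (hT.1 h)
  refine ⟨hT.1.trans (Finset.subset_insert _ _), hbT, ?_⟩
  rw [Finset.erase_eq_of_notMem hbT]
  exact hT.2

lemma card_erase_symmDiff {C N S : Finset V} {b : V} (hbC : b ∈ C) (hS : S ⊆ C) :
    ((symmDiff N S).erase b).card = (N \ C).card + (((symmDiff N S) ∩ C).erase b).card := by
  rw [← Finset.card_union_of_disjoint]
  · congr 1
    ext w
    have := @hS w
    simp only [mem_erase, mem_symmDiff, Finset.mem_union, Finset.mem_sdiff, mem_inter]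
    by_cases hw : w = b
    · subst hw; tauto
    · tauto
  · rw [Finset.disjoint_left]
    intro w hw hw'
    simp only [Finset.mem_sdiff, mem_erase, mem_inter] at hw hw'
    exact hw.2 hw'.2.2

open scoped Classical in
/-- A uniformly random pair of rows fails to cover a given level with probability
at most `1 - q₁ q₂ / 4`. -/
lemma card_not_covering_rows_le (B : Finset V) {b : V} (hb : b ∉ B) (N N' : Finset V)
    (Q : Finset ℕ) (y : ℤ) {q₁ q₂ : ℝ} (hq₂ : 0 ≤ q₂)
    (h₁ : q₁ * 2 ^ B.card
      ≤ (B.powerset.filter fun T => (((N \ insert b B).card + T.card : ℕ) : ℤ) = y).card)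
    (h₂ : q₂ * 2 ^ B.card
      ≤ (B.powerset.filter fun T => (N' \ insert b B).card + T.card ∈ Q).card) :
    ((((insert b B).powerset ×ˢ (insert b B).powerset).filter fun S =>
      ¬ (¬(b ∈ symmDiff N S.1 ↔ b ∈ symmDiff N' S.2) ∧
        (((symmDiff N S.1).erase b).card : ℤ) = y ∧
        ((symmDiff N' S.2).erase b).card ∈ Q)).card : ℝ)
      ≤ (1 - q₁ * q₂ / 4) * ((insert b B).powerset ×ˢ (insert b B).powerset).card := by
  set C := insert b B with hC
  have hbC : b ∈ C := Finset.mem_insert_self _ _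
  set P := C.powerset with hP
  set cov : Finset V × Finset V → Prop := fun S =>
    ¬(b ∈ symmDiff N S.1 ↔ b ∈ symmDiff N' S.2) ∧
        (((symmDiff N S.1).erase b).card : ℤ) = y ∧
        ((symmDiff N' S.2).erase b).card ∈ Q with hcov
  have hcard : (P.card : ℝ) = 2 * 2 ^ B.card := by
    rw [hP, Finset.card_powerset, hC, Finset.card_insert_of_notMem hb, pow_succ]
    push_cast; ring
  have e₁ : q₁ * 2 ^ B.card ≤ (P.filter fun S => b ∈ symmDiff N S ∧
      (((symmDiff N S).erase b).card : ℤ) = y).card := by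
    refine h₁.trans ?_
    have := card_powerset_filter_mem_ge B hb
      (fun r => (((N \ C).card + r : ℕ) : ℤ) = y)
    rw [← hC, ← card_filter_powerset_symmDiff C N
      (fun T => b ∈ T ∧ (((N \ C).card + (T.erase b).card : ℕ) : ℤ) = y)] at this
    refine (Nat.cast_le.2 this).trans (Nat.cast_le.2 (Finset.card_le_card ?_))
    intro S hS
    simp only [Finset.mem_filter, mem_inter, hP, mem_powerset] at hS ⊢
    refine ⟨hS.1, hS.2.1.1, ?_⟩
    rw [card_erase_symmDiff hbC hS.1]
    exact hS.2.2
  have e₂ : q₂ * 2 ^ B.card ≤ (P.filter fun S => b ∉ symmDiff N' S ∧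
      ((symmDiff N' S).erase b).card ∈ Q).card := by
    refine h₂.trans ?_
    have := card_powerset_filter_notMem_ge B hb
      (fun r => (N' \ C).card + r ∈ Q)
    rw [← hC, ← card_filter_powerset_symmDiff C N'
      (fun T => b ∉ T ∧ (N' \ C).card + (T.erase b).card ∈ Q)] at this
    refine (Nat.cast_le.2 this).trans (Nat.cast_le.2 (Finset.card_le_card ?_))
    intro S hS
    simp only [Finset.mem_filter, mem_inter, hP, mem_powerset] at hS ⊢
    refine ⟨hS.1, fun h => hS.2.1 ⟨h, hbC⟩, ?_⟩
    rw [card_erase_symmDiff hbC hS.1]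
    exact hS.2.2
  have hprod : (P.filter fun S => b ∈ symmDiff N S ∧
      (((symmDiff N S).erase b).card : ℤ) = y).card * (P.filter fun S => b ∉ symmDiff N' S ∧
      ((symmDiff N' S).erase b).card ∈ Q).card ≤ ((P ×ˢ P).filter cov).card := by
    rw [← Finset.card_product]
    refine Finset.card_le_card fun S hS => ?_
    simp only [Finset.mem_product, Finset.mem_filter, hcov] at hS ⊢
    tauto
  have hprod' : (q₁ * 2 ^ B.card) * (q₂ * 2 ^ B.card) ≤ ((P ×ˢ P).filter cov).card := by
    refine le_trans ?_ (Nat.cast_le.2 hprod)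
    push_cast
    exact mul_le_mul e₁ e₂ (by positivity) (by positivity)
  have hsplit : (((P ×ˢ P).filter cov).card : ℝ) + ((P ×ˢ P).filter fun S => ¬ cov S).card
      = (P ×ˢ P).card := by
    exact_mod_cast Finset.card_filter_add_card_filter_not cov
  have hPP : ((P ×ˢ P).card : ℝ) = 4 * (2 ^ B.card * 2 ^ B.card) := by
    rw [Finset.card_product]; push_cast; rw [hcard]; ring
  rw [hPP] at hsplit ⊢
  nlinarith

/-- The bipartite graph with prescribed rows. -/
def rowsGraph {ι : Type*} (p : ι × Bool → V) (ω : ι → Finset V × Finset V) : SimpleGraph V :=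
  SimpleGraph.fromEdgeSet
    {e | ∃ i, (∃ c ∈ (ω i).1, e = s(p (i, false), c)) ∨ ∃ c ∈ (ω i).2, e = s(p (i, true), c)}

lemma nb_rowsGraph {ι : Type*} {p : ι × Bool → V} (hp : Function.Injective p) {C : Finset V}
    (hC : ∀ x, p x ∉ C) {ω : ι → Finset V × Finset V}
    (hω : ∀ i, (ω i).1 ⊆ C ∧ (ω i).2 ⊆ C) (i : ι) :
    nb (rowsGraph p ω) (p (i, false)) = (ω i).1 ∧ nb (rowsGraph p ω) (p (i, true)) = (ω i).2 := by
  have hinj : ∀ x y, p x = p y ↔ x = y := fun x y => hp.eq_iff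
  have h1 : ∀ i w, w ∈ (ω i).1 → w ∈ C := fun i w h => (hω i).1 h
  have h2 : ∀ i w, w ∈ (ω i).2 → w ∈ C := fun i w h => (hω i).2 h
  constructor
  · ext w
    simp only [mem_nb, rowsGraph, SimpleGraph.fromEdgeSet_adj, Set.mem_ofPred_eq, Sym2.eq_iff]
    constructor
    · rintro ⟨⟨j, ⟨c, hc, ⟨h, h'⟩ | ⟨h, h'⟩⟩ | ⟨c, hc, ⟨h, h'⟩ | ⟨h, h'⟩⟩⟩, hne⟩
      · rw [hinj, Prod.mk.injEq] at h
        rw [h.1, h']; exact hc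
      · exact (hC _ (h ▸ h1 _ _ hc)).elim
      · rw [hinj] at h; simp at h
      · exact (hC _ (h ▸ h2 _ _ hc)).elim
    · intro hw
      exact ⟨⟨i, Or.inl ⟨w, hw, Or.inl ⟨rfl, rfl⟩⟩⟩, fun h => hC _ (h ▸ h1 _ _ hw)⟩
  · ext w
    simp only [mem_nb, rowsGraph, SimpleGraph.fromEdgeSet_adj, Set.mem_ofPred_eq, Sym2.eq_iff]
    constructor
    · rintro ⟨⟨j, ⟨c, hc, ⟨h, h'⟩ | ⟨h, h'⟩⟩ | ⟨c, hc, ⟨h, h'⟩ | ⟨h, h'⟩⟩⟩, hne⟩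
      · rw [hinj] at h; simp at h
      · exact (hC _ (h ▸ h1 _ _ hc)).elim
      · rw [hinj, Prod.mk.injEq] at h
        rw [h.1, h']; exact hc
      · exact (hC _ (h ▸ h2 _ _ hc)).elim
    · intro hw
      exact ⟨⟨i, Or.inr ⟨w, hw, Or.inl ⟨rfl, rfl⟩⟩⟩, fun h => hC _ (h ▸ h2 _ _ hw)⟩

open scoped Classical in
/-- If the degrees outside `insert b B` satisfy `A`, a given level is uncovered with
exponentially small probability. -/
lemma card_uncovered_le {ι : Type*} [Fintype ι] {p : ι × Bool → V}
    (hp : Function.Injective p) (B : Finset V) {b : V} (hb : b ∉ B)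
    (hC : ∀ x, p x ∉ insert b B) (Q : Finset ℕ) (y : ℤ) {q₁ q₂ : ℝ}
    (hq₂ : 0 ≤ q₂) (hq : q₁ * q₂ ≤ 4) (A : ℕ → Prop)
    (h₁ : ∀ α, A α → q₁ * 2 ^ B.card
      ≤ (B.powerset.filter fun T => ((α + T.card : ℕ) : ℤ) = y).card)
    (h₂ : ∀ α, A α → q₂ * 2 ^ B.card
      ≤ (B.powerset.filter fun T => α + T.card ∈ Q).card) :
    ((univ.filter fun G : SimpleGraph V =>
      (∀ i, ¬ Covers G (p (i, false)) (p (i, true)) b Q y) ∧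
        ∀ x, A (nb G (p x) \ insert b B).card).card : ℝ)
      ≤ (1 - q₁ * q₂ / 4) ^ Fintype.card ι * Fintype.card (SimpleGraph V) := by
  set C := insert b B with hCdef
  set P := C.powerset with hP
  refine card_filter_le_of_symmDiff (Fintype.piFinset fun _ : ι => P ×ˢ P)
    ⟨fun _ => (∅, ∅), by simp [hP]⟩ (rowsGraph p) _ _ fun G => ?_
  have hω : ∀ ω ∈ Fintype.piFinset (fun _ : ι => P ×ˢ P), ∀ i, (ω i).1 ⊆ C ∧ (ω i).2 ⊆ C := by
    intro ω hω i
    have := Fintype.mem_piFinset.1 hω i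
    simpa [hP] using this
  by_cases hA : ∀ x, A (nb G (p x) \ C).card
  · set bad : ι → Finset (Finset V × Finset V) := fun i => (P ×ˢ P).filter fun S =>
      ¬ (¬(b ∈ symmDiff (nb G (p (i, false))) S.1 ↔ b ∈ symmDiff (nb G (p (i, true))) S.2) ∧
        (((symmDiff (nb G (p (i, false))) S.1).erase b).card : ℤ) = y ∧
        ((symmDiff (nb G (p (i, true))) S.2).erase b).card ∈ Q) with hbad
    have hsub : ((Fintype.piFinset fun _ : ι => P ×ˢ P).filter fun ω =>
        (∀ i, ¬ Covers (symmDiff G (rowsGraph p ω)) (p (i, false)) (p (i, true)) b Q y) ∧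
        ∀ x, A (nb (symmDiff G (rowsGraph p ω)) (p x) \ C).card) ⊆ Fintype.piFinset bad := by
      intro ω hm
      rw [Finset.mem_filter] at hm
      rw [Fintype.mem_piFinset]
      intro i
      rw [hbad, Finset.mem_filter]
      refine ⟨Fintype.mem_piFinset.1 hm.1 i, ?_⟩
      have := hm.2.1 i
      unfold Covers at this
      rw [nb_symmDiff, nb_symmDiff, (nb_rowsGraph hp hC (hω ω hm.1) i).1,
        (nb_rowsGraph hp hC (hω ω hm.1) i).2] at this
      exact this
    have e1 : ((Fintype.piFinset bad).card : ℝ) = ∏ i, ((bad i).card : ℝ) := by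
      rw [Fintype.card_piFinset, Nat.cast_prod]
    have e2 : ∏ i, ((bad i).card : ℝ)
        ≤ ∏ _i : ι, ((1 - q₁ * q₂ / 4) * ((P ×ˢ P).card : ℝ)) :=
      Finset.prod_le_prod (fun _ _ => Nat.cast_nonneg _) fun i _ =>
        card_not_covering_rows_le B hb _ _ Q y hq₂ (h₁ _ (hA _)) (h₂ _ (hA _))
    have e3 : ((Fintype.piFinset fun _ : ι => P ×ˢ P).card : ℝ)
        = ((P ×ˢ P).card : ℝ) ^ Fintype.card ι := by
      rw [Fintype.card_piFinset, Finset.prod_const, Finset.card_univ, Nat.cast_pow]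
    rw [Finset.prod_const, mul_pow, Finset.card_univ, ← e3, ← e1] at e2
    exact (Nat.cast_le.2 (Finset.card_le_card hsub)).trans e2
  · have hempty : ((Fintype.piFinset fun _ : ι => P ×ˢ P).filter fun ω =>
        (∀ i, ¬ Covers (symmDiff G (rowsGraph p ω)) (p (i, false)) (p (i, true)) b Q y) ∧
        ∀ x, A (nb (symmDiff G (rowsGraph p ω)) (p x) \ C).card) = ∅ := by
      refine Finset.filter_eq_empty_iff.2 fun ω hm hh => hA fun x => ?_
      have hx := hh.2 x
      have hnb : nb (rowsGraph p ω) (p x) ⊆ C := by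
        obtain ⟨i, β⟩ := x
        cases β
        · rw [(nb_rowsGraph hp hC (hω ω hm) i).1]; exact (hω ω hm i).1
        · rw [(nb_rowsGraph hp hC (hω ω hm) i).2]; exact (hω ω hm i).2
      have : nb (symmDiff G (rowsGraph p ω)) (p x) \ C = nb G (p x) \ C := by
        rw [nb_symmDiff]
        ext w
        have := @hnb w
        simp only [Finset.mem_sdiff, mem_symmDiff]
        tauto
      rwa [this] at hx
    rw [hempty, Finset.card_empty, Nat.cast_zero]
    have : 0 ≤ 1 - q₁ * q₂ / 4 := by linarith
    positivity

lemma choose_le_card_powerset_filter (B : Finset V) (i : ℕ) (R : ℕ → Prop) [DecidablePred R]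
    (hR : R i) : B.card.choose i ≤ (B.powerset.filter fun T => R T.card).card := by
  rw [← Finset.card_powersetCard]
  refine Finset.card_le_card fun T hT => ?_
  rw [Finset.mem_powersetCard] at hT
  rw [Finset.mem_filter, Finset.mem_powerset]
  exact ⟨hT.1, by rw [hT.2]; exact hR⟩

lemma abs_div_sub_div_le {a g r T s D : ℝ} (hT : 0 < T) (hD : 0 < D) (ha : a * D = g * s)
    (hs0 : 0 ≤ s) (hsD : s ≤ D) (hr : 0 ≤ r) {bad : ℝ} (hrb : r ≤ bad) (hg : g + bad = T) :
    |(a + r) / T - s / D| ≤ bad / T := by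
  have hsd : 0 ≤ s / D := div_nonneg hs0 hD.le
  have hsd1 : s / D ≤ 1 := (div_le_one hD).2 hsD
  have ha' : a = g * (s / D) := by field_simp; exact ha
  have e : (a + r) / T - s / D = (r - bad * (s / D)) / T := by
    rw [ha', eq_sub_of_add_eq hg]
    field_simp
    ring
  rw [e, abs_div, abs_of_pos hT]
  refine div_le_div_of_nonneg_right ?_ hT.le
  rw [abs_le]
  constructor <;> nlinarith

/-- Quantitative equidistribution of the parity vector. -/
theorem abs_gprob_parity_sub_le {n δ k m : ℕ} (hn : n = 2 * k + m + 1) (Q : Finset ℕ) (lo : ℤ)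
    (hlo : dstar n ≤ lo) (hQ : ∀ v ∈ Q, dstar n ≤ (v : ℤ))
    (hQlo : ∀ v ∈ Q, ∀ j : Fin δ, (v : ℤ) ≠ lo + (j : ℕ)) (S : Set (Fin δ → ZMod 2))
    {t s q₁ q₂ : ℝ} (hs : 0 ≤ s) (hq₂ : 0 ≤ q₂)
    (hq : q₁ * (Q.card * q₂) ≤ 4)
    (h₁ : ∀ α : ℕ, |(α : ℝ) - (2 * k - 1) / 2| ≤ t → ∀ j : Fin δ, ∃ i : ℕ,
      ((α + i : ℕ) : ℤ) = lo + (j : ℕ) ∧ q₁ * 2 ^ m ≤ m.choose i)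
    (h₂ : ∀ α : ℕ, |(α : ℝ) - (2 * k - 1) / 2| ≤ t → ∀ v ∈ Q, ∃ i : ℕ,
      α + i = v ∧ q₂ * 2 ^ m ≤ m.choose i) :
    |gprob {G : SimpleGraph (Fin n) | (fun j : Fin δ => (Xcount G (lo + (j : ℕ)) : ZMod 2)) ∈ S}
        - Nat.card S / 2 ^ δ|
      ≤ 2 * k * (2 * Real.exp ((2 * k - 1) * s ^ 2 / 2 - 2 * s * t))
        + δ * (1 - q₁ * (Q.card * q₂) / 4) ^ k := by
  classical
  set p : Fin k × Bool → Fin n := fun x =>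
    ⟨if x.2 then k + x.1 else x.1, by have := x.1.2; split_ifs <;> omega⟩ with hpdef
  have hp : Function.Injective p := by
    rintro ⟨i, β⟩ ⟨j, γ⟩ h
    have h' := congrArg Fin.val h
    have hi := i.2
    have hj := j.2
    cases β <;> cases γ <;> simp [hpdef] at h' ⊢ <;> omega
  have hpl : ∀ x, (p x : ℕ) < 2 * k := by
    rintro ⟨i, β⟩
    have hi := i.2
    cases β <;> simp [hpdef] <;> omega
  set b : Fin n := ⟨2 * k + m, by omega⟩ with hbdef
  set B : Finset (Fin n) := Finset.Ico ⟨2 * k, by omega⟩ b with hBdef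
  have hBm : B.card = m := by rw [hBdef, Fin.card_Ico]; simp [hbdef]
  have hb : b ∉ B := by simp [hBdef]
  have hpC : ∀ x, p x ∉ insert b B := by
    intro x hx
    have := hpl x
    rw [Finset.mem_insert, hBdef, Finset.mem_Ico] at hx
    rcases hx with hx | hx
    · rw [hx] at this; simp [hbdef] at this
    · have := Fin.le_def.1 hx.1
      simp at this; omega
  have hpb : ∀ x, p x ≠ b := fun x h => hpC x (h ▸ Finset.mem_insert_self _ _)
  set M : ℝ := (Fintype.card (SimpleGraph (Fin n)) : ℝ) with hM
  have hMpos : 0 < M := by rw [hM]; exact_mod_cast Fintype.card_pos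
  set A : ℕ → Prop := fun α => |(α : ℝ) - (2 * k - 1) / 2| ≤ t with hA
  set cov : Fin δ → Fin k → SimpleGraph (Fin n) → Prop := fun j i G =>
    Covers G (p (i, false)) (p (i, true)) b Q (lo + (j : ℕ)) with hcov
  set Y : SimpleGraph (Fin n) → Fin δ → ZMod 2 :=
    fun G j => (Xcount G (lo + (j : ℕ)) : ZMod 2) with hY
  have hdev : ∀ x, ((univ.filter fun G : SimpleGraph (Fin n) =>
      ¬ A (nb G (p x) \ insert b B).card).card : ℝ)
      ≤ 2 * Real.exp ((2 * k - 1) * s ^ 2 / 2 - 2 * s * t) * M := by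
    intro x
    set C := (univ \ insert b B).erase (p x) with hC
    have hCc : (C.card : ℝ) = 2 * k - 1 := by
      have h1 : C.card + 1 + (m + 1) = n := by
        rw [hC, Finset.card_erase_add_one (by simpa using hpC x), Finset.card_sdiff_of_subset
          (Finset.subset_univ _), Finset.card_insert_of_notMem hb, hBm, Finset.card_univ,
          Fintype.card_fin]
        omega
      have h2 : ((C.card + 1 + (m + 1) : ℕ) : ℝ) = ((2 * k + m + 1 : ℕ) : ℝ) := by rw [h1, ← hn]
      push_cast at h2
      linarith
    have := card_filter_nb_deviation_le (p x) C (by simp [hC]) s t hs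
    rw [hCc] at this
    refine le_trans (Nat.cast_le.2 (Finset.card_le_card ?_)) this
    intro G hG
    rw [Finset.mem_filter] at hG ⊢
    refine ⟨mem_univ _, ?_⟩
    have hset : nb G (p x) ∩ C = nb G (p x) \ insert b B := by
      ext w
      have : p x ∉ nb G (p x) := by simp [mem_nb]
      by_cases hw : w = p x
      · subst hw; simp [this]
      · simp [hC, hw]
    rw [hset]
    exact not_le.1 hG.2
  have hunc : ∀ j, ((univ.filter fun G : SimpleGraph (Fin n) =>
      (∀ i, ¬ cov j i G) ∧ ∀ x, A (nb G (p x) \ insert b B).card).card : ℝ)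
      ≤ (1 - q₁ * (Q.card * q₂) / 4) ^ k * M := by
    intro j
    have := card_uncovered_le (V := Fin n) hp B hb hpC Q (lo + (j : ℕ)) (q₁ := q₁)
      (q₂ := Q.card * q₂) (mul_nonneg (Nat.cast_nonneg _) hq₂) hq A ?_ ?_
    · rw [Fintype.card_fin] at this
      convert this
    · intro α hα
      obtain ⟨i, hi, hle⟩ := h₁ α hα j
      rw [hBm]
      refine hle.trans (Nat.cast_le.2 ?_)
      rw [← hBm]
      convert choose_le_card_powerset_filter B i
        (fun r => ((α + r : ℕ) : ℤ) = lo + (j : ℕ)) hi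
    · intro α hα
      rw [hBm]
      have hfib := Finset.card_eq_sum_card_fiberwise (f := fun T : Finset (Fin n) => α + T.card)
        (s := B.powerset.filter fun T => α + T.card ∈ Q) (t := Q)
        (fun T hT => by
          simp only [coe_filter, Set.mem_ofPred_eq] at hT
          exact hT.2)
      have hle : ∑ v ∈ Q, q₂ * 2 ^ m ≤ ∑ v ∈ Q, (((B.powerset.filter fun T =>
          α + T.card ∈ Q).filter fun T => α + T.card = v).card : ℝ) := by
        refine Finset.sum_le_sum fun v hv => ?_
        obtain ⟨i, hi, hle⟩ := h₂ α hα v hv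
        refine hle.trans (Nat.cast_le.2 ?_)
        rw [← hBm, Finset.filter_filter]
        exact choose_le_card_powerset_filter B i (fun r => α + r ∈ Q ∧ α + r = v)
          ⟨hi ▸ hv, hi⟩
      rw [Finset.sum_const, nsmul_eq_mul, ← Nat.cast_sum, ← mul_assoc] at hle
      refine hle.trans (Nat.cast_le.2 (le_of_eq ?_))
      convert hfib.symm
  set bad := univ.filter fun G : SimpleGraph (Fin n) => ¬ ∀ j, ∃ i, cov j i G with hbad
  have hbadle : (bad.card : ℝ) ≤ (2 * k * (2 * Real.exp ((2 * k - 1) * s ^ 2 / 2 - 2 * s * t))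
        + δ * (1 - q₁ * (Q.card * q₂) / 4) ^ k) * M := by
    have hsub : bad ⊆ (univ.biUnion fun x => univ.filter fun G : SimpleGraph (Fin n) =>
        ¬ A (nb G (p x) \ insert b B).card) ∪ univ.biUnion fun j =>
        univ.filter fun G : SimpleGraph (Fin n) =>
          (∀ i, ¬ cov j i G) ∧ ∀ x, A (nb G (p x) \ insert b B).card := by
      intro G hG
      rw [hbad, Finset.mem_filter] at hG
      have hG2 := hG.2
      push Not at hG2
      obtain ⟨j, hj⟩ := hG2
      rw [Finset.mem_union]
      by_cases hx : ∀ x, A (nb G (p x) \ insert b B).card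
      · right
        exact Finset.mem_biUnion.2 ⟨j, mem_univ _, Finset.mem_filter.2 ⟨mem_univ _, hj, hx⟩⟩
      · left
        push Not at hx
        obtain ⟨x, hx⟩ := hx
        exact Finset.mem_biUnion.2 ⟨x, mem_univ _, Finset.mem_filter.2 ⟨mem_univ _, hx⟩⟩
    have h1 := (Finset.card_le_card hsub).trans ((Finset.card_union_le _ _).trans
      (add_le_add Finset.card_biUnion_le Finset.card_biUnion_le))
    have h2 : (bad.card : ℝ) ≤ _ := Nat.cast_le.2 h1
    push_cast at h2
    refine h2.trans ((add_le_add (Finset.sum_le_sum fun x _ => hdev x)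
      (Finset.sum_le_sum fun j _ => hunc j)).trans (le_of_eq ?_))
    simp only [Finset.sum_const, Finset.card_univ, Fintype.card_prod, Fintype.card_fin,
      Fintype.card_bool, nsmul_eq_mul]
    push_cast
    ring
  have hunif := card_covered_filter_mul (δ := δ) hp hpb Q lo hlo hQ hQlo S
  set good := univ.filter fun G : SimpleGraph (Fin n) => ∀ j, ∃ i, cov j i G with hgood
  set a := univ.filter fun G : SimpleGraph (Fin n) => (∀ j, ∃ i, cov j i G) ∧ Y G ∈ S with ha
  set r := univ.filter fun G : SimpleGraph (Fin n) => (¬ ∀ j, ∃ i, cov j i G) ∧ Y G ∈ S with hr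
  have hunif' : a.card * 2 ^ δ = good.card * Nat.card S := by
    convert hunif
  have hcard : Nat.card {G : SimpleGraph (Fin n) | Y G ∈ S} = a.card + r.card := by
    rw [Nat.card_eq_fintype_card, Fintype.card_subtype,
      ← Finset.card_filter_add_card_filter_not (fun G => ∀ j, ∃ i, cov j i G),
      Finset.filter_filter, Finset.filter_filter]
    congr 2
    · ext G; simp [ha, and_comm]
    · ext G; simp only [hr, Finset.mem_filter, Set.mem_ofPred_eq, mem_univ, true_and]; tauto
  have hM2 : M = 2 ^ (Nat.card (Fin n)).choose 2 := by
    rw [hM, card_simpleGraph, Nat.card_eq_fintype_card]; push_cast; rfl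
  have hfinal := abs_div_sub_div_le (a := a.card) (g := good.card) (r := r.card) (T := M)
    (s := Nat.card S) (D := 2 ^ δ) (bad := bad.card) hMpos (by positivity)
    (by exact_mod_cast hunif') (Nat.cast_nonneg _) ?_ (Nat.cast_nonneg _) ?_ ?_
  · rw [gprob, hcard, ← hM2, Nat.cast_add]
    exact hfinal.trans ((div_le_iff₀ hMpos).2 hbadle)
  · have : Nat.card S ≤ Nat.card (Fin δ → ZMod 2) := Nat.card_le_card_of_injective _
      Subtype.val_injective
    rw [Nat.card_eq_fintype_card (α := Fin δ → ZMod 2), Fintype.card_fun, ZMod.card,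
      Fintype.card_fin] at this
    exact_mod_cast this
  · refine Nat.cast_le.2 (Finset.card_le_card fun G hG => ?_)
    rw [hr, Finset.mem_filter] at hG
    rw [hbad, Finset.mem_filter]
    exact ⟨hG.1, hG.2.1⟩
  · rw [hM]
    exact_mod_cast Finset.card_filter_add_card_filter_not
      (s := (univ : Finset (SimpleGraph (Fin n)))) (fun G => ∀ j, ∃ i, cov j i G)

lemma sixteen_pow_le_centralBinom_sq {h : ℕ} (hh : 1 ≤ h) :
    16 ^ h ≤ h.centralBinom ^ 2 * (4 * h) := by
  induction h, hh using Nat.le_induction with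
  | base => decide
  | succ h hh ih =>
    have e := Nat.succ_mul_centralBinom_succ h
    have h1 : (h + 1) ^ 2 * 16 ^ (h + 1)
        ≤ (h + 1) ^ 2 * ((h + 1).centralBinom ^ 2 * (4 * (h + 1))) := by
      calc (h + 1) ^ 2 * 16 ^ (h + 1) = 16 * (h + 1) ^ 2 * 16 ^ h := by ring
        _ ≤ 16 * (h + 1) ^ 2 * (h.centralBinom ^ 2 * (4 * h)) := by gcongr
        _ = 64 * (h + 1) * h.centralBinom ^ 2 * ((h + 1) * h) := by ring
        _ ≤ 16 * (h + 1) * h.centralBinom ^ 2 * (2 * h + 1) ^ 2 := by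
            have : 4 * ((h + 1) * h) ≤ (2 * h + 1) ^ 2 := by nlinarith
            nlinarith [Nat.mul_le_mul_left (16 * (h + 1) * h.centralBinom ^ 2) this]
        _ = (2 * (2 * h + 1) * h.centralBinom) ^ 2 * (4 * (h + 1)) := by ring
        _ = ((h + 1) * (h + 1).centralBinom) ^ 2 * (4 * (h + 1)) := by rw [e]
        _ = _ := by ring
    exact Nat.le_of_mul_le_mul_left h1 (by positivity)

lemma four_pow_div_le_centralBinom {h : ℕ} (hh : 1 ≤ h) :
    (4 : ℝ) ^ h / (2 * Real.sqrt h) ≤ h.centralBinom := by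
  have h0 : (0 : ℝ) < h := by exact_mod_cast hh
  rw [div_le_iff₀ (by positivity)]
  refine le_of_sq_le_sq ?_ (by positivity)
  have := sixteen_pow_le_centralBinom_sq hh
  have h2 : (16 : ℝ) ^ h ≤ (h.centralBinom : ℝ) ^ 2 * (4 * h) := by exact_mod_cast this
  calc ((4 : ℝ) ^ h) ^ 2 = 16 ^ h := by rw [← pow_mul, mul_comm, pow_mul]; norm_num
    _ ≤ _ := h2
    _ = _ := by rw [mul_pow, mul_pow, Real.sq_sqrt h0.le]; ring

/-- Gaussian lower bound on binomial coefficients to the left of the centre. -/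
lemma centralBinom_mul_exp_le_choose {h N : ℕ} {X : ℝ} (hX : X < h) (hN : (N : ℝ) ≤ X) :
    h.centralBinom * Real.exp (-((N : ℝ) ^ 2 / (h - X))) ≤ ((2 * h).choose (h - N) : ℝ) := by
  induction N with
  | zero => simp [Nat.centralBinom]
  | succ N ih =>
    push_cast at hN
    have ih := ih (by linarith)
    have hd : 0 < (h : ℝ) - X := by linarith
    have hNh : N + 1 < h := by
      have : ((N + 1 : ℕ) : ℝ) < h := by push_cast; linarith
      exact_mod_cast this
    have hrec : (2 * h).choose (h - N) * (h - N) = (2 * h).choose (h - (N + 1)) * (h + N + 1) := by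
      have := Nat.choose_succ_right_eq (2 * h) (h - (N + 1))
      rw [show h - (N + 1) + 1 = h - N by omega,
        show 2 * h - (h - (N + 1)) = h + N + 1 by omega] at this
      exact this
    have hrec' : ((2 * h).choose (h - N) : ℝ) * ((h : ℝ) - N)
        = ((2 * h).choose (h - (N + 1)) : ℝ) * (h + N + 1) := by
      rw [← Nat.cast_sub (by omega : N ≤ h)]
      exact_mod_cast hrec
    have hhN : 0 < (h : ℝ) - N := by linarith
    have hratio : ((h : ℝ) + N + 1) ≤ (h - N) * Real.exp ((2 * N + 1) / (h - X)) := by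
      have h1 : 1 + (2 * N + 1) / ((h : ℝ) - X) ≤ Real.exp ((2 * N + 1) / (h - X)) := by
        linarith [Real.add_one_le_exp ((2 * N + 1) / ((h : ℝ) - X))]
      have h2 : (2 * N + 1 : ℝ) / (h - N) ≤ (2 * N + 1) / (h - X) := by
        gcongr; linarith
      calc (h : ℝ) + N + 1 = (h - N) * (1 + (2 * N + 1) / (h - N)) := by field_simp; ring
        _ ≤ _ := mul_le_mul_of_nonneg_left (by linarith) hhN.le
    have e : Real.exp (-(((N + 1 : ℕ) : ℝ) ^ 2 / (h - X))) * Real.exp ((2 * N + 1) / (h - X))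
        = Real.exp (-((N : ℝ) ^ 2 / (h - X))) := by
      rw [← Real.exp_add]
      congr 1
      push_cast
      field_simp
      ring
    have hpos : 0 < (h : ℝ) + N + 1 := by positivity
    refine le_of_mul_le_mul_right ?_ hpos
    rw [← hrec']
    calc _ ≤ (h.centralBinom : ℝ) * Real.exp (-(((N + 1 : ℕ) : ℝ) ^ 2 / (h - X)))
          * ((h - N) * Real.exp ((2 * N + 1) / (h - X))) := by gcongr
      _ = (h.centralBinom : ℝ) * (Real.exp (-(((N + 1 : ℕ) : ℝ) ^ 2 / (h - X)))
          * Real.exp ((2 * N + 1) / (h - X))) * (h - N) := by ring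
      _ ≤ _ := by rw [e]; gcongr

/-- Gaussian lower bound on binomial coefficients. -/
lemma two_pow_mul_exp_le_choose {m i : ℕ} {X : ℝ} (hm : 2 ≤ m)
    (hX : X < (m / 2 : ℕ)) (hi : |((m / 2 : ℕ) : ℝ) - i| ≤ X) :
    Real.exp (-(X ^ 2 / ((m / 2 : ℕ) - X))) / (4 * Real.sqrt (m / 2 : ℕ)) * 2 ^ m
      ≤ m.choose i := by
  set h := m / 2 with hh
  have h1 : 1 ≤ h := by omega
  have h0 : (0 : ℝ) < h := by exact_mod_cast h1
  have hd : 0 < (h : ℝ) - X := by linarith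
  have hX0 : 0 ≤ X := (abs_nonneg _).trans hi
  have key : ∀ N : ℕ, (N : ℝ) ≤ X →
      Real.exp (-(X ^ 2 / (h - X))) / (4 * Real.sqrt h) * 2 ^ m
        ≤ ((2 * h).choose (h - N) : ℝ) := by
    intro N hN
    refine le_trans ?_ (centralBinom_mul_exp_le_choose hX hN)
    have hpow : (2 : ℝ) ^ m ≤ 2 * 4 ^ h := by
      have : (2 : ℝ) ^ m ≤ 2 ^ (2 * h + 1) := pow_le_pow_right₀ (by norm_num) (by omega)
      refine this.trans (le_of_eq ?_)
      rw [pow_succ, pow_mul]; norm_num; ring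
    calc _ ≤ Real.exp (-((N : ℝ) ^ 2 / (h - X))) / (4 * Real.sqrt h) * (2 * 4 ^ h) := by gcongr
      _ = 4 ^ h / (2 * Real.sqrt h) * Real.exp (-((N : ℝ) ^ 2 / (h - X))) := by
          field_simp; ring
      _ ≤ _ := by
          gcongr
          exact four_pow_div_le_centralBinom h1
  have hmono : ((2 * h).choose i : ℝ) ≤ m.choose i :=
    Nat.cast_le.2 (Nat.choose_le_choose i (by omega))
  refine le_trans ?_ hmono
  rcases le_total i h with hih | hih
  · have := key (h - i) (by rw [Nat.cast_sub hih]; exact (le_abs_self _).trans hi)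
    rwa [Nat.sub_sub_self hih] at this
  · have hih2 : (i : ℝ) - h ≤ X := by rw [abs_sub_comm] at hi; exact (le_abs_self _).trans hi
    have hi2 : i ≤ 2 * h := by
      have : (i : ℝ) ≤ (2 * h : ℕ) := by push_cast; linarith
      exact_mod_cast this
    have := key (i - h) (by rw [Nat.cast_sub hih]; exact hih2)
    rwa [show h - (i - h) = 2 * h - i by omega, Nat.choose_symm hi2] at this

lemma bnd_le {n : ℕ} (hL : 1 ≤ Real.sqrt (Real.log n)) :
    bnd n ≤ Real.sqrt n * (Real.sqrt (Real.log n) - 1) / 2 := by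
  set L := Real.sqrt (Real.log n) with hLdef
  have hlog : Real.log n = L ^ 2 := by
    rw [hLdef, Real.sq_sqrt]
    by_contra h
    rw [hLdef, Real.sqrt_eq_zero_of_nonpos (not_le.1 h).le] at hL
    linarith
  have h0 : (0 : ℝ) ≤ n := Nat.cast_nonneg n
  have : Real.sqrt ((n : ℝ) * (Real.log n - 2 * L)) ≤ Real.sqrt n * (L - 1) := by
    rw [Real.sqrt_mul h0, hlog]
    gcongr
    rw [Real.sqrt_le_left (by linarith)]
    nlinarith
  rw [bnd]
  linarith

lemma sq_div_sub_le {L R h X : ℝ} (hL : 2 ≤ L) (hX0 : 0 ≤ X)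
    (hX : X ≤ R * (L - 1 / 2) / 2) (hh : R ^ 2 / 2 * (1 - 1 / L ^ 2) ≤ h - X)
    (hpos : 0 < h - X) : X ^ 2 / (h - X) ≤ L ^ 2 / 2 - L / 2 + 2 := by
  rw [div_le_iff₀ hpos]
  have h1 : X ^ 2 ≤ (R * (L - 1 / 2) / 2) ^ 2 := by gcongr
  have h2 : (L ^ 2 / 2 - L / 2 + 2) * (R ^ 2 / 2 * (1 - 1 / L ^ 2))
      ≤ (L ^ 2 / 2 - L / 2 + 2) * (h - X) :=
    mul_le_mul_of_nonneg_left hh (by nlinarith)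
  refine h1.trans (le_trans ?_ h2)
  have hl : (1 : ℝ) / L ^ 2 ≤ 1 / 4 := by
    rw [div_le_div_iff₀ (by positivity) (by norm_num)]; nlinarith
  have h3 : (L ^ 2 / 2 - L / 2 + 2) * (1 - 1 / L ^ 2)
      = L ^ 2 / 2 - L / 2 + 2 - 1 / 2 + 1 / (2 * L) - 2 * (1 / L ^ 2) := by
    field_simp; ring
  have h4 : (0 : ℝ) ≤ 1 / (2 * L) := by positivity
  calc (R * (L - 1 / 2) / 2) ^ 2 = R ^ 2 / 2 * (L ^ 2 / 2 - L / 2 + 1 / 8) := by ring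
    _ ≤ R ^ 2 / 2 * ((L ^ 2 / 2 - L / 2 + 2) * (1 - 1 / L ^ 2)) := by
        refine mul_le_mul_of_nonneg_left ?_ (by positivity)
        rw [h3]; linarith
    _ = _ := by ring

set_option maxHeartbeats 1000000 in
/-- The parity vector is within `1 / n` of being uniformly distributed, for large `n`. -/
theorem eventually_abs_gprob_parity_sub_le :
    ∀ᶠ n : ℕ in atTop, ∀ (δ : ℕ) (Q : Finset ℕ) (lo : ℤ) (S : Set (Fin δ → ZMod 2)),
      dstar n ≤ lo → (∀ v ∈ Q, dstar n ≤ (v : ℤ)) →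
      (∀ v ∈ Q, ∀ j : Fin δ, (v : ℤ) ≠ lo + (j : ℕ)) →
      (∀ j : Fin δ, |((lo + (j : ℕ) : ℤ) : ℝ) - n / 2| ≤ bnd n) →
      (∀ v ∈ Q, |(v : ℝ) - n / 2| ≤ Real.sqrt n + 1) →
      Real.sqrt n ≤ Q.card → Q.card ≤ n → δ ≤ n →
      |gprob {G : SimpleGraph (Fin n) | (fun j : Fin δ => (Xcount G (lo + (j : ℕ)) : ZMod 2)) ∈ S}
        - Nat.card S / 2 ^ δ| ≤ 1 / n := by
  have hLt : Tendsto (fun n : ℕ => Real.sqrt (Real.log n)) atTop atTop :=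
    Real.tendsto_sqrt_atTop.comp (Real.tendsto_log_atTop.comp tendsto_natCast_atTop_atTop)
  have ev1 := hLt.eventually_ge_atTop 100
  have ev2 : ∀ᶠ n : ℕ in atTop, Real.sqrt (Real.log n) ^ 10 ≤ Real.sqrt n := by
    have h1 : ∀ᶠ x : ℝ in atTop, x ^ 20 ≤ Real.exp x := by
      have := (Real.isLittleO_pow_exp_atTop (n := 20)).bound one_pos
      filter_upwards [this, eventually_ge_atTop 0] with x hx hx0
      simpa [abs_of_nonneg hx0] using hx
    have h2 : ∀ᶠ x : ℝ in atTop, x ^ 10 ≤ Real.exp x := by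
      filter_upwards [h1, eventually_ge_atTop 1] with x hx hx1
      exact (pow_le_pow_right₀ hx1 (by norm_num)).trans hx
    filter_upwards [(Real.tendsto_log_atTop.comp tendsto_natCast_atTop_atTop).eventually h2,
      eventually_ge_atTop 2] with n hn hn2
    have hn0 : (0 : ℝ) < n := by positivity
    have hlog : 0 ≤ Real.log n := Real.log_natCast_nonneg n
    simp only [Function.comp, Real.exp_log hn0] at hn
    refine Real.le_sqrt_of_sq_le ?_
    rw [← pow_mul, mul_comm, pow_mul, Real.sq_sqrt hlog]
    exact hn
  have ev3 : ∀ᶠ n : ℕ in atTop, 384 * Real.exp 38 * Real.sqrt (Real.log n) ^ 8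
      ≤ Real.exp (Real.sqrt (Real.log n) / 2) := by
    have h1 : ∀ᶠ x : ℝ in atTop, 384 * Real.exp 38 * x ^ 8 ≤ Real.exp (x / 2) := by
      have := (isLittleO_pow_exp_pos_mul_atTop 8 (b := 1 / 2) (by norm_num)).bound
        (c := 1 / (384 * Real.exp 38)) (by positivity)
      filter_upwards [this, eventually_ge_atTop 0] with x hx hx0
      rw [Real.norm_of_nonneg (by positivity), Real.norm_of_nonneg (by positivity),
        one_div_mul_eq_div, le_div_iff₀ (by positivity)] at hx
      rw [mul_comm, show x / 2 = 1 / 2 * x by ring]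
      exact hx
    exact hLt.eventually h1
  filter_upwards [ev1, ev2, ev3, eventually_ge_atTop 100] with n hL hR hE hn100
  intro δ Q lo S hlo hQ hQlo hlob hQb hQ1 hQ2 hδ
  have hbnd := bnd_le (n := n) (by linarith)
  have hbnd0 : 0 ≤ bnd n := by rw [bnd]; positivity
  set L := Real.sqrt (Real.log n) with hLdef
  set R := Real.sqrt n with hRdef
  have hlog : Real.log n = L ^ 2 := (Real.sq_sqrt (Real.log_natCast_nonneg n)).symm
  have hN : (n : ℝ) = R ^ 2 := (Real.sq_sqrt (Nat.cast_nonneg n)).symm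
  have hn0 : (0 : ℝ) < n := by positivity
  have hL0 : 0 < L := by linarith
  have hL10 : (100 : ℝ) ^ 10 ≤ L ^ 10 := by gcongr
  have hR100 : 100 ^ 10 ≤ R := hL10.trans hR
  have hR0 : 0 < R := lt_of_lt_of_le (by norm_num) hR100
  have hLR : L * 10 ^ 10 ≤ R := by
    have : L * 100 ^ 9 ≤ L ^ 10 := by
      rw [pow_succ' L 9]; gcongr
    linarith
  have hL6 : (100 : ℝ) ^ 4 * L ^ 2 ≤ L ^ 6 := by
    rw [show L ^ 6 = L ^ 4 * L ^ 2 by ring]; gcongr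
  have hL3 : 100 ^ 7 * L ^ 3 ≤ R := by
    refine le_trans ?_ hR
    rw [show L ^ 10 = L ^ 7 * L ^ 3 by ring]; gcongr
  have hL6R : L ^ 6 ≤ R := (pow_le_pow_right₀ (by linarith) (by norm_num)).trans hR
  have hRsq : 0 < R ^ 2 := by positivity
  have hRR : 100 ^ 10 * R ≤ R ^ 2 := by rw [sq]; gcongr
  have hL2 : 100 ^ 2 ≤ L ^ 2 := by gcongr
  obtain ⟨k, hk⟩ : ∃ k, k = ⌊(n : ℝ) / L ^ 6⌋₊ := ⟨_, rfl⟩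
  have hk1 : (k : ℝ) ≤ R ^ 2 / L ^ 6 := by rw [hk, ← hN]; exact Nat.floor_le (by positivity)
  have hbig : (2 : ℝ) ≤ R ^ 2 / L ^ 6 := by
    rw [le_div_iff₀ (by positivity)]; linarith
  have hk2 : R ^ 2 / L ^ 6 / 2 ≤ k := by
    have := Nat.lt_floor_add_one ((n : ℝ) / L ^ 6)
    rw [← hk, hN] at this
    linarith
  have hk0 : (0 : ℝ) < k := by linarith
  have hkL : R ^ 2 / L ^ 6 ≤ R ^ 2 / (8 * L ^ 2) := by
    gcongr; linarith
  have hkN : R ^ 2 / (8 * L ^ 2) ≤ R ^ 2 / 80000 := by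
    gcongr; linarith
  have h2k : 2 * k + 1 ≤ n := by
    have : ((2 * k + 1 : ℕ) : ℝ) ≤ n := by push_cast; rw [hN]; linarith
    exact_mod_cast this
  obtain ⟨m, hm⟩ : ∃ m, n = 2 * k + m + 1 := ⟨n - 1 - 2 * k, by omega⟩
  have hmR : (m : ℝ) = R ^ 2 - 2 * k - 1 := by
    rw [← hN, hm]; push_cast; ring
  set h := m / 2 with hh
  have hh1 : (h : ℝ) ≤ m / 2 := Nat.cast_div_le
  have hh2 : (m : ℝ) / 2 - 1 / 2 ≤ h := by
    have : m ≤ 2 * h + 1 := by omega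
    have : (m : ℝ) ≤ 2 * h + 1 := by exact_mod_cast this
    linarith
  have hhN : (h : ℝ) ≤ R ^ 2 := by linarith
  have hhlow : R ^ 2 / 2 - k - 1 ≤ h := by linarith
  have hm2 : 2 ≤ m := by
    have : ((2 : ℕ) : ℝ) ≤ m := by push_cast; linarith
    exact_mod_cast this
  set t := R / L with ht
  have ht0 : 0 < t := by positivity
  have htR : t ≤ R / 100 := by rw [ht]; gcongr
  obtain ⟨X₁, hX₁⟩ : ∃ X₁, X₁ = bnd n + t + 2 := ⟨_, rfl⟩
  obtain ⟨X₂, hX₂⟩ : ∃ X₂, X₂ = R + 1 + t + 2 := ⟨_, rfl⟩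
  have hX₁le : X₁ ≤ R * (L - 1 / 2) / 2 := by rw [hX₁]; linarith
  have hX₁' : R ^ 2 / 2 * (1 - 1 / L ^ 2) ≤ h - X₁ := by
    have e1 : R * L / 2 ≤ R ^ 2 / (8 * L ^ 2) := by
      rw [div_le_div_iff₀ (by norm_num) (by positivity)]
      have h1 := mul_le_mul_of_nonneg_left hL3 hR0.le
      have h2 : 0 ≤ R * L ^ 3 := by positivity
      linarith
    have e2 : 1 ≤ R ^ 2 / (8 * L ^ 2) := by linarith
    have e3 : R ^ 2 / 2 * (1 - 1 / L ^ 2) = R ^ 2 / 2 - 4 * (R ^ 2 / (8 * L ^ 2)) := by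
      field_simp; ring
    rw [e3]; linarith
  have hhalf : R ^ 2 / 4 ≤ R ^ 2 / 2 * (1 - 1 / L ^ 2) := by
    have : 1 / L ^ 2 ≤ 1 / 2 := by
      rw [div_le_div_iff₀ (by positivity) (by norm_num)]; linarith
    linarith [mul_le_mul_of_nonneg_left this hRsq.le]
  have hX₁h : 0 < h - X₁ := by linarith
  have hX₂le : X₂ ≤ 3 * R := by linarith
  have hX₂' : R ^ 2 / 4 ≤ h - X₂ := by linarith
  have hX₂h : 0 < h - X₂ := by linarith
  have hh4 : R ^ 2 / 4 ≤ h := by linarith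
  have hh0 : (0 : ℝ) < h := by linarith
  obtain ⟨q₁, hq₁⟩ : ∃ q, q = Real.exp (-(X₁ ^ 2 / (h - X₁))) / (4 * Real.sqrt h) := ⟨_, rfl⟩
  obtain ⟨q₂, hq₂⟩ : ∃ q, q = Real.exp (-(X₂ ^ 2 / (h - X₂))) / (4 * Real.sqrt h) := ⟨_, rfl⟩
  have hsh : Real.sqrt h ≤ R := by
    rw [Real.sqrt_le_left hR0.le]; exact hhN
  have hsh0 : 0 < Real.sqrt h := Real.sqrt_pos.2 hh0
  have hq₁0 : 0 ≤ q₁ := by rw [hq₁]; positivity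
  have hq₂0 : 0 ≤ q₂ := by rw [hq₂]; positivity
  have hq₁u : q₁ ≤ 1 / (4 * Real.sqrt h) := by
    rw [hq₁]
    gcongr
    rw [Real.exp_le_one_iff, neg_nonpos]
    positivity
  have hq₂u : q₂ ≤ 1 / (4 * Real.sqrt h) := by
    rw [hq₂]
    gcongr
    rw [Real.exp_le_one_iff, neg_nonpos]
    positivity
  have hq₁l : Real.exp (L / 2 - 2) / (4 * R ^ 2) ≤ q₁ := by
    have e1 : Real.exp (L / 2 - 2 - L ^ 2 / 2) ≤ Real.exp (-(X₁ ^ 2 / (h - X₁))) := by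
      rw [Real.exp_le_exp]
      linarith [sq_div_sub_le (L := L) (R := R) (h := h) (X := X₁) (by linarith) (by linarith)
        hX₁le hX₁' hX₁h]
    have e2 : Real.exp (L ^ 2 / 2) = R := by
      rw [← hlog, hRdef, ← Real.log_sqrt hn0.le, Real.exp_log hR0]
    rw [hq₁]
    calc Real.exp (L / 2 - 2) / (4 * R ^ 2) = Real.exp (L / 2 - 2 - L ^ 2 / 2) / (4 * R) := by
          rw [Real.exp_sub _ (L ^ 2 / 2), e2]; field_simp
      _ ≤ _ := by gcongr
  have hq₂l : Real.exp (-36) / (4 * R) ≤ q₂ := by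
    rw [hq₂]
    gcongr
    rw [div_le_iff₀ hX₂h]
    have : X₂ ^ 2 ≤ (3 * R) ^ 2 := by
      have : 0 ≤ X₂ := by linarith
      gcongr
    linarith
  obtain ⟨c, hc⟩ : ∃ c, c = (Q.card : ℝ) := ⟨_, rfl⟩
  rw [← hc] at hQ1
  have hc0 : 0 ≤ c := by linarith
  have hprod : q₁ * (c * q₂) ≤ 4 := by
    have e1 : c ≤ R ^ 2 := by rw [← hN, hc]; exact_mod_cast hQ2
    calc q₁ * (c * q₂) ≤ 1 / (4 * Real.sqrt h) * (R ^ 2 * (1 / (4 * Real.sqrt h))) := by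
          gcongr
      _ = R ^ 2 / (16 * Real.sqrt h ^ 2) := by field_simp; norm_num
      _ ≤ 4 := by
          rw [Real.sq_sqrt hh0.le, div_le_iff₀ (by positivity)]
          linarith
  have hmain : 3 * L ^ 2 ≤ k * (q₁ * (c * q₂) / 4) := by
    have e1 : Real.exp (L / 2 - 2) * Real.exp (-36) = Real.exp (L / 2) / Real.exp 38 := by
      rw [← Real.exp_add, ← Real.exp_sub]; ring_nf
    calc 3 * L ^ 2 = 384 * Real.exp 38 * L ^ 8 / (128 * L ^ 6 * Real.exp 38) := by
          field_simp; norm_num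
      _ ≤ Real.exp (L / 2) / (128 * L ^ 6 * Real.exp 38) := by gcongr
      _ = R ^ 2 / L ^ 6 / 2 * (Real.exp (L / 2 - 2) / (4 * R ^ 2)
            * (R * (Real.exp (-36) / (4 * R))) / 4) := by
          have : R ^ 2 / L ^ 6 / 2 * (Real.exp (L / 2 - 2) / (4 * R ^ 2)
            * (R * (Real.exp (-36) / (4 * R))) / 4)
            = (Real.exp (L / 2 - 2) * Real.exp (-36)) / (128 * L ^ 6) := by
            field_simp; norm_num
          rw [this, e1]; field_simp
      _ ≤ _ := by gcongr
  have key := abs_gprob_parity_sub_le hm Q lo hlo hQ hQlo S (t := t) (s := t / k) (q₁ := q₁)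
    (q₂ := q₂) (by positivity) hq₂0 (by rw [← hc]; exact hprod) ?_ ?_
  · rw [← hc] at key
    refine key.trans ?_
    have e0 : 0 ≤ 1 - q₁ * (c * q₂) / 4 := by linarith
    have b0 : 0 ≤ (1 - q₁ * (c * q₂) / 4) ^ k := pow_nonneg e0 k
    have hexp3 : Real.exp (-(3 * L ^ 2)) = 1 / R ^ 6 := by
      rw [← hlog, Real.exp_neg, show 3 * Real.log n = ((3 : ℕ) : ℝ) * Real.log n by norm_num,
        Real.exp_nat_mul, Real.exp_log hn0, hN, one_div, ← pow_mul]
    have b1 : Real.exp ((2 * k - 1) * (t / k) ^ 2 / 2 - 2 * (t / k) * t) ≤ 1 / R ^ 6 := by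
      rw [← hexp3, Real.exp_le_exp]
      have e1 : (2 * k - 1) * (t / k) ^ 2 / 2 - 2 * (t / k) * t
          = - (t ^ 2 / k) - (t / k) ^ 2 / 2 := by field_simp; ring
      have e2 : L ^ 4 ≤ t ^ 2 / k := by
        rw [le_div_iff₀ hk0]
        calc L ^ 4 * k ≤ L ^ 4 * (R ^ 2 / L ^ 6) := by gcongr
          _ = t ^ 2 := by rw [ht]; field_simp
      have e3 : 3 * L ^ 2 ≤ L ^ 4 := by nlinarith
      rw [e1]
      linarith [sq_nonneg (t / k)]
    have b2 : (1 - q₁ * (c * q₂) / 4) ^ k ≤ 1 / R ^ 6 := by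
      calc (1 - q₁ * (c * q₂) / 4) ^ k ≤ Real.exp (-(q₁ * (c * q₂) / 4)) ^ k := by
            gcongr
            linarith [Real.add_one_le_exp (-(q₁ * (c * q₂) / 4))]
        _ = Real.exp (-(k * (q₁ * (c * q₂) / 4))) := by
            rw [← Real.exp_nat_mul]; ring_nf
        _ ≤ Real.exp (-(3 * L ^ 2)) := by gcongr
        _ = _ := hexp3
    have hδ' : (δ : ℝ) ≤ R ^ 2 := by rw [← hN]; exact_mod_cast hδ
    have hkR : (k : ℝ) ≤ R ^ 2 := by linarith
    calc _ ≤ 2 * R ^ 2 * (2 * (1 / R ^ 6)) + R ^ 2 * (1 / R ^ 6) := by gcongr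
      _ = 5 / R ^ 2 / R ^ 2 := by field_simp; norm_num
      _ ≤ 1 / R ^ 2 := by
          gcongr
          rw [div_le_one hRsq]; linarith
      _ = 1 / n := by rw [hN]
  · intro α hα j
    have hy := hlob j
    obtain ⟨y, hy'⟩ : ∃ y, y = lo + (j : ℕ) := ⟨_, rfl⟩
    rw [← hy'] at hy ⊢
    rw [abs_le, hN] at hy
    rw [abs_le] at hα
    have hle : (α : ℤ) ≤ y := by
      have : ((α : ℤ) : ℝ) ≤ y := by push_cast; linarith
      exact_mod_cast this
    refine ⟨(y - α).toNat, by push_cast; rw [Int.toNat_of_nonneg (by omega)]; ring, ?_⟩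
    rw [hq₁]
    refine two_pow_mul_exp_le_choose hm2 (by linarith) ?_
    have e : (((y - α).toNat : ℕ) : ℝ) = y - α := by
      have : (((y - α).toNat : ℕ) : ℤ) = y - α := Int.toNat_of_nonneg (by omega)
      have := congrArg (Int.cast : ℤ → ℝ) this
      push_cast at this
      exact this
    rw [e, abs_le]
    constructor <;> linarith
  · intro α hα v hv
    have hy := hQb v hv
    rw [abs_le, hN] at hy
    rw [abs_le] at hα
    have hle : α ≤ v := by
      have : (α : ℝ) ≤ v := by linarith
      exact_mod_cast this
    refine ⟨v - α, by omega, ?_⟩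
    rw [hq₂]
    refine two_pow_mul_exp_le_choose hm2 (by linarith) ?_
    rw [Nat.cast_sub hle, abs_le]
    constructor <;> linarith

lemma tendsto_sqrt_mul_log :
    Tendsto (fun n : ℕ => Real.sqrt ((n : ℝ) * Real.log n)) atTop atTop :=
  Real.tendsto_sqrt_atTop.comp
    ((tendsto_natCast_atTop_atTop (R := ℝ)).atTop_mul_atTop₀
      (Real.tendsto_log_atTop.comp tendsto_natCast_atTop_atTop))

lemma tendsto_sqrt_mul_log_div :
    Tendsto (fun n : ℕ => Real.sqrt ((n : ℝ) * Real.log n) / n) atTop (nhds 0) := by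
  have h1 : Tendsto (fun n : ℕ => Real.log n / (n : ℝ)) atTop (nhds 0) := by
    have := Real.isLittleO_log_id_atTop.tendsto_div_nhds_zero
    exact this.comp tendsto_natCast_atTop_atTop
  have h2 := (Real.continuous_sqrt.tendsto 0).comp h1
  rw [Real.sqrt_zero] at h2
  refine h2.congr' ?_
  filter_upwards [eventually_gt_atTop 0] with n hn
  have hn0 : (0 : ℝ) < n := by exact_mod_cast hn
  simp only [Function.comp]
  rw [eq_div_iff hn0.ne', ← Real.sqrt_sq hn0.le, ← Real.sqrt_mul' _ (by positivity),
    Real.sqrt_sq hn0.le]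
  congr 1
  field_simp

lemma tendsto_bnd_div :
    Tendsto (fun n : ℕ => bnd n / Real.sqrt ((n : ℝ) * Real.log n)) atTop (nhds (1 / 2)) := by
  have hLt : Tendsto (fun n : ℕ => Real.sqrt (Real.log n)) atTop atTop :=
    Real.tendsto_sqrt_atTop.comp (Real.tendsto_log_atTop.comp tendsto_natCast_atTop_atTop)
  have h1 : Tendsto (fun n : ℕ => 1 - 2 / Real.sqrt (Real.log n)) atTop (nhds (1 - 0)) :=
    tendsto_const_nhds.sub (hLt.const_div_atTop 2)
  have h2 := ((Real.continuous_sqrt.tendsto _).comp h1).const_mul (1 / 2)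
  rw [sub_zero, Real.sqrt_one, mul_one] at h2
  refine h2.congr' ?_
  filter_upwards [eventually_gt_atTop 0, hLt.eventually_gt_atTop 2] with n hn hL
  have hn0 : (0 : ℝ) < n := by exact_mod_cast hn
  set L := Real.sqrt (Real.log n) with hLdef
  have hlog : Real.log n = L ^ 2 := (Real.sq_sqrt (Real.log_natCast_nonneg n)).symm
  have hL0 : 0 < L := by linarith
  simp only [Function.comp]
  rw [bnd, ← hLdef, hlog, mul_div_assoc, ← Real.sqrt_div' _ (by positivity)]
  congr 2
  field_simp

/-- If the probability is within `1 / n` of the density of an asymptotically optimal code of length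
`δ ~ √(n log n) / 2`, then it is asymptotic to `2 / √(n log n)`. -/
lemma tendsto_sqrt_mul_of_density {δ s : ℕ → ℕ} {P : ℕ → ℝ}
    (hδ : ∀ᶠ n in atTop, |(δ n : ℝ) - bnd n| ≤ 2)
    (hs : Tendsto (fun n => (s n : ℝ) * ((δ n : ℝ) + 1) / 2 ^ δ n) atTop (nhds 1))
    (hP : ∀ᶠ n in atTop, |P n - s n / 2 ^ δ n| ≤ 1 / n) :
    Tendsto (fun n : ℕ => Real.sqrt ((n : ℝ) * Real.log n) * P n) atTop (nhds 2) := by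
  set w : ℕ → ℝ := fun n => Real.sqrt ((n : ℝ) * Real.log n) with hw
  have hwt : Tendsto w atTop atTop := tendsto_sqrt_mul_log
  have h1 : Tendsto (fun n => ((δ n : ℝ) + 1 - bnd n) / w n) atTop (nhds 0) := by
    refine squeeze_zero_norm' ?_ (hwt.const_div_atTop 3)
    filter_upwards [hδ, hwt.eventually_gt_atTop 0] with n hn hwn
    rw [Real.norm_eq_abs, abs_div, abs_of_pos hwn]
    rw [abs_le] at hn
    gcongr
    rw [abs_le]
    constructor <;> linarith
  have h2 : Tendsto (fun n => w n / ((δ n : ℝ) + 1)) atTop (nhds 2) := by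
    have := (tendsto_bnd_div.add h1).inv₀ (by norm_num)
    rw [show ((1 : ℝ) / 2 + 0)⁻¹ = 2 by norm_num] at this
    refine this.congr fun n => ?_
    rw [← add_div, inv_div]
    congr 1
    ring
  have h3 := hs.mul h2
  have h4 : Tendsto (fun n => w n * (P n - s n / 2 ^ δ n)) atTop (nhds 0) := by
    refine squeeze_zero_norm' ?_ tendsto_sqrt_mul_log_div
    filter_upwards [hP] with n hn
    have hwn : 0 ≤ w n := Real.sqrt_nonneg _
    rw [Real.norm_eq_abs, abs_mul, abs_of_nonneg hwn]
    exact (mul_le_mul_of_nonneg_left hn hwn).trans_eq (mul_one_div _ _)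
  have h5 := h3.add h4
  rw [one_mul, add_zero] at h5
  refine h5.congr fun n => ?_
  have : (δ n : ℝ) + 1 ≠ 0 := by positivity
  field_simp
  ring

lemma eventually_bnd_bounds :
    ∀ᶠ n : ℕ in atTop, Real.sqrt n + 2 ≤ bnd n ∧ bnd n + 2 ≤ n ∧ Real.sqrt n + 2 ≤ n / 2 := by
  have hLt : Tendsto (fun n : ℕ => Real.sqrt (Real.log n)) atTop atTop :=
    Real.tendsto_sqrt_atTop.comp (Real.tendsto_log_atTop.comp tendsto_natCast_atTop_atTop)
  filter_upwards [tendsto_bnd_div.eventually_const_le (by norm_num : (1 : ℝ) / 4 < 1 / 2),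
    hLt.eventually_ge_atTop 100, eventually_ge_atTop 100] with n h1 hL hn
  have hb := bnd_le (n := n) (by linarith)
  have hn' : (100 : ℝ) ≤ n := by exact_mod_cast hn
  rw [Real.sqrt_mul (Nat.cast_nonneg n)] at h1
  have hLR : Real.sqrt (Real.log n) ≤ Real.sqrt n :=
    Real.sqrt_le_sqrt (Real.log_le_self (Nat.cast_nonneg n))
  have hR10 : 10 ≤ Real.sqrt n := Real.le_sqrt_of_sq_le (by linarith)
  have hN : (n : ℝ) = Real.sqrt n ^ 2 := (Real.sq_sqrt (Nat.cast_nonneg n)).symm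
  rw [le_div_iff₀ (by positivity)] at h1
  refine ⟨?_, ?_, ?_⟩
  · nlinarith
  · nlinarith
  · nlinarith

lemma half_bounds (n : ℕ) :
    (n : ℝ) / 2 - 1 / 2 ≤ (n / 2 : ℕ) ∧ ((n / 2 : ℕ) : ℝ) ≤ (n : ℝ) / 2 := by
  have h1 : n ≤ 2 * (n / 2) + 1 := by omega
  have h2 : (n : ℝ) ≤ 2 * (n / 2 : ℕ) + 1 := by exact_mod_cast h1
  exact ⟨by linarith, Nat.cast_div_le⟩

lemma dstar_bounds (n : ℕ) :
    (n : ℝ) / 2 - bnd n ≤ dstar n ∧ (dstar n : ℝ) < (n : ℝ) / 2 - bnd n + 1 :=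
  ⟨Int.le_ceil _, Int.ceil_lt_add_one _⟩

lemma dtop_bounds (n : ℕ) :
    (n : ℝ) / 2 + bnd n - 1 < dtop n ∧ (dtop n : ℝ) ≤ (n : ℝ) / 2 + bnd n :=
  ⟨Int.sub_one_lt_floor _, Int.floor_le _⟩

lemma eventually_delta1_eq :
    ∀ᶠ n : ℕ in atTop, (delta1 n : ℤ) = (n / 2 : ℕ) - dstar n := by
  filter_upwards [eventually_bnd_bounds] with n ⟨h1, h2, h3⟩
  rw [delta1]
  have hh := half_bounds n
  generalize n / 2 = c at hh ⊢
  refine Int.toNat_of_nonneg ?_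
  have : (dstar n : ℝ) ≤ (c : ℤ) := by
    push_cast
    linarith [dstar_bounds n, Real.sqrt_nonneg n]
  have : dstar n ≤ (c : ℤ) := by exact_mod_cast this
  omega

lemma eventually_delta2_eq :
    ∀ᶠ n : ℕ in atTop, (delta2 n : ℤ) = dtop n - (n / 2 : ℕ) := by
  filter_upwards [eventually_bnd_bounds] with n ⟨h1, h2, h3⟩
  rw [delta2]
  have hh := half_bounds n
  generalize n / 2 = c at hh ⊢
  refine Int.toNat_of_nonneg ?_
  have : ((c : ℤ) : ℝ) ≤ dtop n := by
    push_cast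
    linarith [dtop_bounds n, Real.sqrt_nonneg n]
  have : (c : ℤ) ≤ dtop n := by exact_mod_cast this
  omega

lemma eventually_abs_delta1_sub_le : ∀ᶠ n : ℕ in atTop, |(delta1 n : ℝ) - bnd n| ≤ 2 := by
  filter_upwards [eventually_delta1_eq] with n hn
  have h1 := half_bounds n
  generalize n / 2 = c at h1 hn
  have h : (delta1 n : ℝ) = c - dstar n := by exact_mod_cast hn
  have h2 := dstar_bounds n
  rw [h, abs_le]
  constructor <;> linarith

lemma eventually_abs_delta2_sub_le : ∀ᶠ n : ℕ in atTop, |(delta2 n : ℝ) - bnd n| ≤ 2 := by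
  filter_upwards [eventually_delta2_eq] with n hn
  have h1 := half_bounds n
  generalize n / 2 = c at h1 hn
  have h : (delta2 n : ℝ) = dtop n - c := by exact_mod_cast hn
  have h2 := dtop_bounds n
  rw [h, abs_le]
  constructor <;> linarith

lemma eventually_abs_gprob_Ydown_sub_le (S : ∀ n : ℕ, Set (Fin (delta1 n) → ZMod 2)) :
    ∀ᶠ n : ℕ in atTop, |gprob {G : SimpleGraph (Fin n) | Ydown G ∈ S n}
      - Nat.card (S n) / 2 ^ delta1 n| ≤ 1 / n := by
  filter_upwards [eventually_abs_gprob_parity_sub_le, eventually_bnd_bounds, eventually_delta1_eq,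
    eventually_abs_delta1_sub_le] with n key ⟨hb1, hb2, hb3⟩ hδ hδb
  have hh := half_bounds n
  obtain ⟨c, hc⟩ : ∃ c, c = n / 2 := ⟨_, rfl⟩
  rw [← hc] at hδ hh
  have hd := dstar_bounds n
  have hs := Real.sqrt_nonneg n
  have hf1 := Nat.floor_le hs
  have hf2 := Nat.lt_floor_add_one (Real.sqrt n)
  have hδR : (delta1 n : ℝ) = c - dstar n := by exact_mod_cast hδ
  refine key (delta1 n) (Finset.Icc c (c + ⌊Real.sqrt n⌋₊)) (dstar n) (S n) le_rfl
    ?_ ?_ ?_ ?_ ?_ ?_ ?_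
  · intro v hv
    rw [Finset.mem_Icc] at hv
    omega
  · intro v hv j
    rw [Finset.mem_Icc] at hv
    have := j.2
    omega
  · intro j
    have hj : ((j : ℕ) : ℝ) + 1 ≤ delta1 n := by exact_mod_cast j.2
    have hj0 : (0 : ℝ) ≤ (j : ℕ) := Nat.cast_nonneg _
    push_cast
    rw [abs_le]
    constructor <;> linarith
  · intro v hv
    rw [Finset.mem_Icc] at hv
    have h1 : (c : ℝ) ≤ v := Nat.cast_le.2 hv.1
    have h2 : (v : ℝ) ≤ c + ⌊Real.sqrt n⌋₊ := by exact_mod_cast hv.2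
    rw [abs_le]
    constructor <;> linarith
  · rw [Nat.card_Icc, show c + ⌊Real.sqrt n⌋₊ + 1 - c = ⌊Real.sqrt n⌋₊ + 1 by omega]
    push_cast
    exact hf2.le
  · rw [Nat.card_Icc, show c + ⌊Real.sqrt n⌋₊ + 1 - c = ⌊Real.sqrt n⌋₊ + 1 by omega]
    have : ((⌊Real.sqrt n⌋₊ + 1 : ℕ) : ℝ) ≤ n := by push_cast; linarith
    exact_mod_cast this
  · have : (delta1 n : ℝ) ≤ n := by linarith [(abs_le.1 hδb).2]
    exact_mod_cast this

lemma eventually_abs_gprob_Yup_sub_le (S : ∀ n : ℕ, Set (Fin (delta2 n) → ZMod 2)) :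
    ∀ᶠ n : ℕ in atTop, |gprob {G : SimpleGraph (Fin n) | Yup G ∈ S n}
      - Nat.card (S n) / 2 ^ delta2 n| ≤ 1 / n := by
  filter_upwards [eventually_abs_gprob_parity_sub_le, eventually_bnd_bounds, eventually_delta2_eq,
    eventually_abs_delta2_sub_le] with n key ⟨hb1, hb2, hb3⟩ hδ hδb
  have hh := half_bounds n
  obtain ⟨c, hc⟩ : ∃ c, c = n / 2 := ⟨_, rfl⟩
  rw [← hc] at hδ hh
  have hd := dstar_bounds n
  have ht := dtop_bounds n
  have hs := Real.sqrt_nonneg n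
  have hf1 := Nat.floor_le hs
  have hf2 := Nat.lt_floor_add_one (Real.sqrt n)
  have hδR : (delta2 n : ℝ) = dtop n - c := by exact_mod_cast hδ
  have hfn : ⌊Real.sqrt n⌋₊ ≤ c := by
    have : (⌊Real.sqrt n⌋₊ : ℝ) ≤ c := by linarith
    exact_mod_cast this
  have hdn : dstar n ≤ c - ⌊Real.sqrt n⌋₊ := by
    have : (dstar n : ℝ) ≤ ((c - ⌊Real.sqrt n⌋₊ : ℤ) : ℝ) := by push_cast; linarith
    exact_mod_cast this
  have hcard : (Finset.Icc (c - ⌊Real.sqrt n⌋₊) c).card = ⌊Real.sqrt n⌋₊ + 1 := by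
    rw [Nat.card_Icc]
    omega
  refine key (delta2 n) (Finset.Icc (c - ⌊Real.sqrt n⌋₊) c) ((n / 2 : ℕ) + 1) (S n)
    ?_ ?_ ?_ ?_ ?_ ?_ ?_ ?_
  · rw [← hc]
    omega
  · intro v hv
    rw [Finset.mem_Icc] at hv
    omega
  · intro v hv j
    rw [← hc]
    rw [Finset.mem_Icc] at hv
    omega
  · intro j
    have hj : ((j : ℕ) : ℝ) + 1 ≤ delta2 n := by exact_mod_cast j.2
    have hj0 : (0 : ℝ) ≤ (j : ℕ) := Nat.cast_nonneg _
    rw [← hc]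
    push_cast
    rw [abs_le]
    constructor <;> linarith
  · intro v hv
    rw [Finset.mem_Icc] at hv
    have h1 : (v : ℝ) ≤ c := Nat.cast_le.2 hv.2
    have h2 : (c : ℝ) ≤ v + ⌊Real.sqrt n⌋₊ := by
      have : c ≤ v + ⌊Real.sqrt n⌋₊ := by omega
      exact_mod_cast this
    rw [abs_le]
    constructor <;> linarith
  · rw [hcard]
    push_cast
    exact hf2.le
  · rw [hcard]
    have : ((⌊Real.sqrt n⌋₊ + 1 : ℕ) : ℝ) ≤ n := by push_cast; linarith
    exact_mod_cast this
  · have : (delta2 n : ℝ) ≤ n := by linarith [(abs_le.1 hδb).2]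
    exact_mod_cast this

end RandomGraph

/-- For asymptotically optimal covering codes `S↓`, `S↑` of lengths `δ₁`, `δ₂`,
`√(n ln n) · P[Y↓(G_n) ∈ S↓] → 2` and `√(n ln n) · P[Y↑(G_n) ∈ S↑] → 2`. -/
theorem prob_parity_vector_in_covering_code
    (Sd : ∀ n : ℕ, Set (Fin (delta1 n) → ZMod 2))
    (Su : ∀ n : ℕ, Set (Fin (delta2 n) → ZMod 2))
    (hSd : ∀ n, IsCoveringCode (Sd n)) (hSu : ∀ n, IsCoveringCode (Su n))
    (hSdOpt : Tendsto
      (fun n : ℕ => (Nat.card (Sd n) : ℝ) * ((delta1 n : ℝ) + 1) / 2 ^ delta1 n)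
      atTop (nhds 1))
    (hSuOpt : Tendsto
      (fun n : ℕ => (Nat.card (Su n) : ℝ) * ((delta2 n : ℝ) + 1) / 2 ^ delta2 n)
      atTop (nhds 1)) :
    Tendsto (fun n : ℕ => Real.sqrt ((n : ℝ) * Real.log n) *
        gprob {G : SimpleGraph (Fin n) | Ydown G ∈ Sd n}) atTop (nhds 2) ∧
    Tendsto (fun n : ℕ => Real.sqrt ((n : ℝ) * Real.log n) *
        gprob {G : SimpleGraph (Fin n) | Yup G ∈ Su n}) atTop (nhds 2) := by
  exact ⟨tendsto_sqrt_mul_of_density eventually_abs_delta1_sub_le hSdOpt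
      (eventually_abs_gprob_Ydown_sub_le Sd),
    tendsto_sqrt_mul_of_density eventually_abs_delta2_sub_le hSuOpt
      (eventually_abs_gprob_Yup_sub_le Su)⟩
end
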